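/- arXiv:0712.2641 — 9 statements merged into one kernel-verified Lean document; each statement's English description precedes it below -/
import Mathlib

section
/- Let k be a field with char k ≠ 2, V a finite-dimensional k-vector space, β a nondegenerate symmetric bilinear form on V, and γ an alternating trilinear form on V. On C = k ⊕ V define a k-bilinear multiplication by (a, u)·(b, v) = (ab − (1/2)·β(u,v), a·v + b·u + γ(u,v,·)†), with identity e = (1, 0), and define the quadratic form N : C → k by N(a, u) = a² + (1/2)·β(u,u). Then N(x·y) = N(x)·N(y) for all x, y ∈ C if and only if γ and β are compatible, i.e. 2·γ(u, v, γ(u,v,·)†) = β(u,u)·β(v,v) − β(u,v)² for all u, v ∈ V. -/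
open Module

/-- On `C = k ⊕ V` with the multiplication defined from compatible-candidate
forms `β` and `γ`, the norm `N(a,u) = a² + (1/2)β(u,u)` is multiplicative iff `γ` and `β`
are compatible. -/
theorem norm_multiplicative_iff_compatible
    {k : Type*} [Field k] (hchar : (2 : k) ≠ 0)
    {V : Type*} [AddCommGroup V] [Module k V] [FiniteDimensional k V]
    (β : V →ₗ[k] V →ₗ[k] k)
    (hβsymm : ∀ u v : V, β u v = β v u)
    (hβnd : ∀ u : V, (∀ v : V, β u v = 0) → u = 0)
    (γ : V [⋀^Fin 3]→ₗ[k] k)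
    (dag : V → V → V)
    (hdag : ∀ u v x : V, β (dag u v) x = γ ![u, v, x])
    (mul : k × V → k × V → k × V)
    (hmul : ∀ (a b : k) (u v : V),
      mul (a, u) (b, v) = (a * b - (1 / 2) * β u v, a • v + b • u + dag u v))
    (N : k × V → k)
    (hN : ∀ (a : k) (u : V), N (a, u) = a ^ 2 + (1 / 2) * β u u) :
    (∀ x y : k × V, N (mul x y) = N x * N y) ↔
      (∀ u v : V, 2 * γ ![u, v, dag u v] = β u u * β v v - (β u v) ^ 2) := by
  have norm_mul_sub (a b : k) (u v : V) :
      4 * (N (mul (a, u) (b, v)) - N (a, u) * N (b, v)) =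
        2 * γ ![u, v, dag u v] - (β u u * β v v - (β u v) ^ 2) := by
    have dag_left : β (dag u v) u = 0 := by
      rw [hdag]
      exact γ.map_eq_zero_of_eq _ (i := 0) (j := 2) rfl (by decide)
    have dag_right : β (dag u v) v = 0 := by
      rw [hdag]
      exact γ.map_eq_zero_of_eq _ (i := 1) (j := 2) rfl (by decide)
    rw [hmul, hN, hN, hN, ← hdag]
    simp only [map_add, map_smul, LinearMap.add_apply, LinearMap.smul_apply, smul_eq_mul,
      hβsymm u (dag u v), hβsymm v (dag u v), hβsymm v u, dag_left, dag_right]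
    field_simp
    ring
  have four_ne_zero : (4 : k) ≠ 0 := by
    rw [show (4 : k) = 2 * 2 by norm_num]
    exact mul_ne_zero hchar hchar
  constructor
  · intro h u v
    rw [← sub_eq_zero, ← norm_mul_sub 0 0 u v, h, sub_self, mul_zero]
  · rintro h ⟨a, u⟩ ⟨b, v⟩
    have hzero := norm_mul_sub a b u v
    rw [h, sub_self] at hzero
    exact sub_eq_zero.mp ((mul_eq_zero.mp hzero).resolve_left four_ne_zero)
end

section
/- Let k be a field with char k ≠ 2, V a finite-dimensional k-vector space, and suppose γ (an alternating trilinear form) and β (a nondegenerate symmetric bilinear form) on V are compatible. Let C = k ⊕ V carry the multiplication (a, u)·(b, v) = (ab − (1/2)·β(u,v), a·v + b·u + γ(u,v,·)†). Then for any subspace L ⊆ V with dim L ≥ 2, the following are equivalent: (i) γ(u, v, x) = 0 for all u, v ∈ L and all x ∈ V (L is γ-isotropic); (ii) u·v = 0 in C for all u, v ∈ L (where u, v are viewed in the summand V of C). Moreover, when these hold, β(u, v) = 0 for all u, v ∈ L; in particular every γ-isotropic subspace is β-isotropic. -/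
open Module

/-- If `γ(u, v, ·) = 0`, then compatibility forces `β(u, u) v = β(u, v) u`. -/
theorem smul_eq_smul_of_compatible
    {k : Type*} [Field k] (hchar : (2 : k) ≠ 0)
    {V : Type*} [AddCommGroup V] [Module k V]
    (β : V →ₗ[k] V →ₗ[k] k)
    (hβsymm : ∀ u v : V, β u v = β v u)
    (hβnd : ∀ u : V, (∀ v : V, β u v = 0) → u = 0)
    (γ : V [⋀^Fin 3]→ₗ[k] k)
    (dag : V → V → V)
    (hdag : ∀ u v x : V, β (dag u v) x = γ ![u, v, x])
    (hcompat : ∀ u v : V, 2 * γ ![u, v, dag u v] = β u u * β v v - (β u v) ^ 2)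
    {u v : V} (huv : ∀ x : V, γ ![u, v, x] = 0) :
    β u u • v = β u v • u := by
  have hadd (w x : V) : γ ![u, v + w, x] = γ ![u, w, x] := by
    have h := γ.map_update_add ![u, v, x] 1 v w
    have hupd (y : V) : Function.update ![u, v, x] 1 y = ![u, y, x] := by
      ext i
      fin_cases i <;> rfl
    simpa [hupd, huv] using h
  have hdag_add (w : V) : dag u (v + w) = dag u w := by
    refine sub_eq_zero.mp (hβnd _ fun x => ?_)
    simp [hdag, hadd]
  refine sub_eq_zero.mp (hβnd _ fun w => ?_)
  have h₁ := hcompat u (v + w)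
  rw [hdag_add, hadd, hcompat u w] at h₁
  have h₂ := hcompat u v
  rw [huv] at h₂
  simp only [map_add, LinearMap.add_apply, hβsymm w v] at h₁
  simp only [map_sub, map_smul, LinearMap.sub_apply, LinearMap.smul_apply, smul_eq_mul]
  refine (mul_eq_zero.mp ?_).resolve_left hchar
  linear_combination h₂ - h₁

/-- For compatible forms `γ` and `β` on `V` and the induced composition-algebra
multiplication on `C = k ⊕ V`, a subspace `L` with `dim L ≥ 2` is `γ`-isotropic iff all
products of its elements vanish in `C`; in that case `β` vanishes on `L`. -/
theorem gammaIsotropic_iff_mul_eq_zero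
    {k : Type*} [Field k] (hchar : (2 : k) ≠ 0)
    {V : Type*} [AddCommGroup V] [Module k V] [FiniteDimensional k V]
    (β : V →ₗ[k] V →ₗ[k] k)
    (hβsymm : ∀ u v : V, β u v = β v u)
    (hβnd : ∀ u : V, (∀ v : V, β u v = 0) → u = 0)
    (γ : V [⋀^Fin 3]→ₗ[k] k)
    (dag : V → V → V)
    (hdag : ∀ u v x : V, β (dag u v) x = γ ![u, v, x])
    (hcompat : ∀ u v : V, 2 * γ ![u, v, dag u v] = β u u * β v v - (β u v) ^ 2)
    (mul : k × V → k × V → k × V)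
    (hmul : ∀ (a b : k) (u v : V),
      mul (a, u) (b, v) = (a * b - (1 / 2) * β u v, a • v + b • u + dag u v))
    (L : Submodule k V) (hL : 2 ≤ finrank k L) :
    ((∀ u ∈ L, ∀ v ∈ L, ∀ x : V, γ ![u, v, x] = 0) ↔
        (∀ u ∈ L, ∀ v ∈ L, mul (0, u) (0, v) = (0, 0))) ∧
      ((∀ u ∈ L, ∀ v ∈ L, ∀ x : V, γ ![u, v, x] = 0) →
        ∀ u ∈ L, ∀ v ∈ L, β u v = 0) := by
  have hβ (h : ∀ u ∈ L, ∀ v ∈ L, ∀ x : V, γ ![u, v, x] = 0) (u : V) (hu : u ∈ L) (v : V)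
      (hv : v ∈ L) : β u v = 0 := by
    have hsmul (w : V) (hw : w ∈ L) : β u u • w = β u w • u :=
      smul_eq_smul_of_compatible hchar β hβsymm hβnd γ dag hdag hcompat (h u hu w hw)
    have huu : β u u = 0 := by
      by_contra hne
      have hle : L ≤ Submodule.span k {u} := fun w hw =>
        Submodule.mem_span_singleton.mpr
          ⟨(β u u)⁻¹ * β u w, by rw [mul_smul, ← hsmul w hw, inv_smul_smul₀ hne]⟩
      have h₁ := Submodule.finrank_mono hle
      have h₂ := finrank_span_le_card (R := k) ({u} : Set V)
      rw [Set.toFinset_singleton, Finset.card_singleton] at h₂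
      omega
    have hzero := hsmul v hv
    rw [huu, zero_smul] at hzero
    rcases smul_eq_zero.mp hzero.symm with h0 | h0
    · exact h0
    · simp [h0]
  refine ⟨⟨fun h u hu v hv => ?_, fun h u hu v hv x => ?_⟩, hβ⟩
  · have hd : dag u v = 0 := hβnd _ fun x => by rw [hdag, h u hu v hv]
    simp [hmul, hβ h u hu v hv, hd]
  · have hm := h u hu v hv
    rw [hmul] at hm
    have hd : dag u v = 0 := by simpa using congrArg Prod.snd hm
    rw [← hdag, hd, map_zero, LinearMap.zero_apply]
end

section
/- Let k be an algebraically closed field with char k ∉ {2, 3}, and V a 7-dimensional k-vector space. Let γ be an alternating trilinear form on V. Fix a nonzero alternating 7-form ω on V, and define a symmetric bilinear form β_γ on V by requiring that for all u, v ∈ V, the alternating 7-form (ι_u γ) ∧ (ι_v γ) ∧ γ (the wedge product of the 2-forms ι_u γ and ι_v γ with the 3-form γ) equals −3·β_γ(u, v)·ω. Then γ is nondegenerate (i.e. admits a compatible nondegenerate symmetric bilinear form) if and only if β_γ is nondegenerate. -/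
open Module

/-- The alternating sum of `F` over all rearrangements of `y`. -/
def signedSum {R α : Type*} [CommRing R] {n : ℕ} (F : (Fin n → α) → R) (y : Fin n → α) : R :=
  ∑ σ : Equiv.Perm (Fin n), ((Equiv.Perm.sign σ : ℤ) : R) * F fun i => y (σ i)

theorem signedSum_comp_perm {R α : Type*} [CommRing R] {n : ℕ} (F : (Fin n → α) → R)
    (y : Fin n → α) (c : Equiv.Perm (Fin n)) :
    signedSum F (fun i => y (c i)) = ((Equiv.Perm.sign c : ℤ) : R) * signedSum F y := by
  unfold signedSum
  rw [← Equiv.sum_comp (Equiv.mulLeft c) fun σ : Equiv.Perm (Fin n) =>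
    ((Equiv.Perm.sign σ : ℤ) : R) * F fun i => y (σ i), Finset.mul_sum]
  refine Finset.sum_congr rfl fun σ _ => ?_
  rcases Int.units_eq_one_or (Equiv.Perm.sign c) with h | h <;> simp [h]

theorem signedSum_const_mul {R α : Type*} [CommRing R] {n : ℕ} (r : R) (F : (Fin n → α) → R)
    (y : Fin n → α) : signedSum (fun z => r * F z) y = r * signedSum F y := by
  simp only [signedSum, Finset.mul_sum]
  exact Finset.sum_congr rfl fun _ _ => by ring

/-- Expansion of a signed sum over permutations along the first argument. -/
theorem signedSum_succ {R α : Type*} [CommRing R] {n : ℕ}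
    {F : (Fin (n + 1) → α) → R} {G : α → (Fin n → α) → R} (hFG : ∀ a z, F (Fin.cons a z) = G a z)
    (y : Fin (n + 1) → α) :
    signedSum F y = ∑ p : Fin (n + 1), (-1) ^ (p : ℕ) *
      signedSum (G (y p)) fun i => y (p.succAbove i) := by
  have swap_form : signedSum F y = ∑ p : Fin (n + 1), (if p = 0 then 1 else -1) *
      signedSum (fun z => F (Fin.cons (y p) z)) fun i => y (Equiv.swap 0 p i.succ) := by
    unfold signedSum
    rw [← Equiv.Perm.decomposeFin.symm.sum_comp, Fintype.sum_prod_type]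
    refine Finset.sum_congr rfl fun p _ => ?_
    rw [Finset.mul_sum]
    refine Finset.sum_congr rfl fun e _ => ?_
    have : (fun i => y (Equiv.Perm.decomposeFin.symm (p, e) i)) =
        Fin.cons (y p) fun i => y (Equiv.swap 0 p (e i).succ) := by
      funext i
      refine Fin.cases ?_ (fun i => ?_) i <;> simp
    rw [this, Equiv.Perm.decomposeFin.symm_sign]
    split_ifs <;> simp
  rw [swap_form]
  simp only [hFG]
  refine Finset.sum_congr rfl fun p _ => ?_
  refine Fin.cases ?_ (fun p => ?_) p
  · simp
  · simp only [← Fin.succAbove_cycleRange]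
    rw [signedSum_comp_perm _ (fun i => y (p.succ.succAbove i)) p.cycleRange]
    simp [Fin.sign_cycleRange, pow_succ]

/-- Twelve times this is the signed sum of `g ⊗ h` over the permutations of five arguments. -/
def wedgeTwoThree {R α : Type*} [CommRing R] (g : α → α → R) (h : α → α → α → R)
    (a b c d e : α) : R :=
  g a b * h c d e - g a c * h b d e + g a d * h b c e - g a e * h b c d
    + g b c * h a d e - g b d * h a c e + g b e * h a c d
    + g c d * h a b e - g c e * h a b d + g d e * h a b c

/-- The wedge product of two `2`-forms and a `3`-form, evaluated at seven vectors. -/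
def wedgeTwoTwoThree {R α : Type*} [CommRing R] (f g : α → α → R) (h : α → α → α → R)
    (y : Fin 7 → α) : R :=
  f (y 0) (y 1) * wedgeTwoThree g h (y 2) (y 3) (y 4) (y 5) (y 6)
    - f (y 0) (y 2) * wedgeTwoThree g h (y 1) (y 3) (y 4) (y 5) (y 6)
    + f (y 0) (y 3) * wedgeTwoThree g h (y 1) (y 2) (y 4) (y 5) (y 6)
    - f (y 0) (y 4) * wedgeTwoThree g h (y 1) (y 2) (y 3) (y 5) (y 6)
    + f (y 0) (y 5) * wedgeTwoThree g h (y 1) (y 2) (y 3) (y 4) (y 6)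
    - f (y 0) (y 6) * wedgeTwoThree g h (y 1) (y 2) (y 3) (y 4) (y 5)
    + f (y 1) (y 2) * wedgeTwoThree g h (y 0) (y 3) (y 4) (y 5) (y 6)
    - f (y 1) (y 3) * wedgeTwoThree g h (y 0) (y 2) (y 4) (y 5) (y 6)
    + f (y 1) (y 4) * wedgeTwoThree g h (y 0) (y 2) (y 3) (y 5) (y 6)
    - f (y 1) (y 5) * wedgeTwoThree g h (y 0) (y 2) (y 3) (y 4) (y 6)
    + f (y 1) (y 6) * wedgeTwoThree g h (y 0) (y 2) (y 3) (y 4) (y 5)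
    + f (y 2) (y 3) * wedgeTwoThree g h (y 0) (y 1) (y 4) (y 5) (y 6)
    - f (y 2) (y 4) * wedgeTwoThree g h (y 0) (y 1) (y 3) (y 5) (y 6)
    + f (y 2) (y 5) * wedgeTwoThree g h (y 0) (y 1) (y 3) (y 4) (y 6)
    - f (y 2) (y 6) * wedgeTwoThree g h (y 0) (y 1) (y 3) (y 4) (y 5)
    + f (y 3) (y 4) * wedgeTwoThree g h (y 0) (y 1) (y 2) (y 5) (y 6)
    - f (y 3) (y 5) * wedgeTwoThree g h (y 0) (y 1) (y 2) (y 4) (y 6)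
    + f (y 3) (y 6) * wedgeTwoThree g h (y 0) (y 1) (y 2) (y 4) (y 5)
    + f (y 4) (y 5) * wedgeTwoThree g h (y 0) (y 1) (y 2) (y 3) (y 6)
    - f (y 4) (y 6) * wedgeTwoThree g h (y 0) (y 1) (y 2) (y 3) (y 5)
    + f (y 5) (y 6) * wedgeTwoThree g h (y 0) (y 1) (y 2) (y 3) (y 4)

section

variable {R α : Type*} [CommRing R]

theorem signedSum_two (g : α → α → R) (y : Fin 2 → α) :
    signedSum (fun z => g (z 0) (z 1)) y = g (y 0) (y 1) - g (y 1) (y 0) := by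
  rw [signedSum_succ (G := fun a z => g a (z 0)) fun _ _ => rfl]
  simp [signedSum, Fin.sum_univ_succ]
  ring

theorem signedSum_three {h : α → α → α → R}
    (h₁ : ∀ a b c, h b a c = -h a b c) (h₂ : ∀ a b c, h a c b = -h a b c) (y : Fin 3 → α) :
    signedSum (fun z => h (z 0) (z 1) (z 2)) y = 6 * h (y 0) (y 1) (y 2) := by
  rw [signedSum_succ (G := fun a z => h a (z 0) (z 1)) fun _ _ => rfl]
  simp only [signedSum_two, Fin.sum_univ_succ]
  simp [Fin.succAbove]
  rw [h₂ (y 0) (y 1) (y 2), h₂ (y 1) (y 0) (y 2), h₂ (y 2) (y 0) (y 1),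
    h₁ (y 0) (y 2) (y 1), h₂ (y 0) (y 1) (y 2), h₁ (y 0) (y 1) (y 2)]
  ring

theorem signedSum_five {g : α → α → R} {h : α → α → α → R} (hg : ∀ a b, g b a = -g a b)
    (h₁ : ∀ a b c, h b a c = -h a b c) (h₂ : ∀ a b c, h a c b = -h a b c) (y : Fin 5 → α) :
    signedSum (fun z => g (z 0) (z 1) * h (z 2) (z 3) (z 4)) y =
      12 * wedgeTwoThree g h (y 0) (y 1) (y 2) (y 3) (y 4) := by
  have key (a : α) (y : Fin 4 → α) :
      signedSum (fun z => g a (z 0) * h (z 1) (z 2) (z 3)) y =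
        6 * (g a (y 0) * h (y 1) (y 2) (y 3) - g a (y 1) * h (y 0) (y 2) (y 3)
          + g a (y 2) * h (y 0) (y 1) (y 3) - g a (y 3) * h (y 0) (y 1) (y 2)) := by
    rw [signedSum_succ (G := fun b z => g a b * h (z 0) (z 1) (z 2)) fun _ _ => rfl]
    simp only [signedSum_const_mul, signedSum_three h₁ h₂, Fin.sum_univ_succ]
    simp [Fin.succAbove]
    ring
  rw [signedSum_succ (G := fun a z => g a (z 0) * h (z 1) (z 2) (z 3)) fun _ _ => rfl]
  simp only [key, Fin.sum_univ_succ]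
  simp [Fin.succAbove]
  rw [hg (y 0) (y 1), hg (y 0) (y 2), hg (y 0) (y 3), hg (y 0) (y 4), hg (y 1) (y 2),
    hg (y 1) (y 3), hg (y 1) (y 4), hg (y 2) (y 3), hg (y 2) (y 4), hg (y 3) (y 4)]
  simp only [wedgeTwoThree]
  ring

theorem signedSum_seven {f g : α → α → R} {h : α → α → α → R} (hf : ∀ a b, f b a = -f a b)
    (hg : ∀ a b, g b a = -g a b) (h₁ : ∀ a b c, h b a c = -h a b c)
    (h₂ : ∀ a b c, h a c b = -h a b c) (y : Fin 7 → α) :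
    signedSum (fun z => f (z 0) (z 1) * g (z 2) (z 3) * h (z 4) (z 5) (z 6)) y =
      24 * wedgeTwoTwoThree f g h y := by
  have key (a : α) (y : Fin 6 → α) :
      signedSum (fun z => f a (z 0) * g (z 1) (z 2) * h (z 3) (z 4) (z 5)) y =
        12 * (f a (y 0) * wedgeTwoThree g h (y 1) (y 2) (y 3) (y 4) (y 5)
          - f a (y 1) * wedgeTwoThree g h (y 0) (y 2) (y 3) (y 4) (y 5)
          + f a (y 2) * wedgeTwoThree g h (y 0) (y 1) (y 3) (y 4) (y 5)
          - f a (y 3) * wedgeTwoThree g h (y 0) (y 1) (y 2) (y 4) (y 5)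
          + f a (y 4) * wedgeTwoThree g h (y 0) (y 1) (y 2) (y 3) (y 5)
          - f a (y 5) * wedgeTwoThree g h (y 0) (y 1) (y 2) (y 3) (y 4)) := by
    rw [signedSum_succ (G := fun b z => f a b * (g (z 0) (z 1) * h (z 2) (z 3) (z 4)))
      fun _ _ => mul_assoc _ _ _]
    simp only [signedSum_const_mul, signedSum_five hg h₁ h₂, Fin.sum_univ_succ]
    simp [Fin.succAbove]
    ring
  rw [signedSum_succ (G := fun a z => f a (z 0) * g (z 1) (z 2) * h (z 3) (z 4) (z 5))
    fun _ _ => rfl]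
  simp only [key, Fin.sum_univ_succ]
  simp [Fin.succAbove]
  rw [hf (y 0) (y 1), hf (y 0) (y 2), hf (y 0) (y 3), hf (y 0) (y 4), hf (y 0) (y 5),
    hf (y 0) (y 6), hf (y 1) (y 2), hf (y 1) (y 3), hf (y 1) (y 4), hf (y 1) (y 5),
    hf (y 1) (y 6), hf (y 2) (y 3), hf (y 2) (y 4), hf (y 2) (y 5), hf (y 2) (y 6),
    hf (y 3) (y 4), hf (y 3) (y 5), hf (y 3) (y 6), hf (y 4) (y 5), hf (y 4) (y 6),
    hf (y 5) (y 6)]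
  simp only [wedgeTwoTwoThree]
  ring

end

/-- The matrix of the standard symplectic form on the last six of seven coordinates. -/
def darboux (R : Type*) [CommRing R] : Matrix (Fin 7) (Fin 7) R :=
  !![0, 0, 0, 0, 0, 0, 0;
     0, 0, 0, 0, 1, 0, 0;
     0, 0, 0, 0, 0, 1, 0;
     0, 0, 0, 0, 0, 0, 1;
     0, -1, 0, 0, 0, 0, 0;
     0, 0, -1, 0, 0, 0, 0;
     0, 0, 0, -1, 0, 0, 0]

section

variable {R : Type*} [CommRing R] {h : Fin 7 → Fin 7 → Fin 7 → R}

theorem wedge_darboux_zero (h₀ : ∀ a b, h a a b = 0) (h₁ : ∀ a b c, h b a c = -h a b c)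
    (h₂ : ∀ a b c, h a c b = -h a b c) (hd : ∀ i j, h 0 i j = darboux R i j) :
    wedgeTwoTwoThree (h 0) (h 0) h id = -6 ∧
    wedgeTwoTwoThree (h 0) (h 1) h id = -3 * h 1 2 5 - 3 * h 1 3 6 ∧
    wedgeTwoTwoThree (h 0) (h 2) h id = 3 * h 1 2 4 - 3 * h 2 3 6 ∧
    wedgeTwoTwoThree (h 0) (h 3) h id = 3 * h 1 3 4 + 3 * h 2 3 5 ∧
    wedgeTwoTwoThree (h 0) (h 4) h id = 3 * h 2 4 5 + 3 * h 3 4 6 ∧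
    wedgeTwoTwoThree (h 0) (h 5) h id = -3 * h 1 4 5 + 3 * h 3 5 6 ∧
    wedgeTwoTwoThree (h 0) (h 6) h id = -3 * h 1 4 6 - 3 * h 2 5 6 := by
  have s₁ : ∀ a b c : Fin 7, a < b → h b a c = -h a b c := fun a b c _ => h₁ a b c
  have s₂ : ∀ a b c : Fin 7, b < c → h a c b = -h a b c := fun a b c _ => h₂ a b c
  have h₀' : ∀ a b, h a b b = 0 := fun a b => by rw [h₁, h₂, h₁, h₀]; simp
  refine ⟨?_, ?_, ?_, ?_, ?_, ?_, ?_⟩ <;>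
  · simp [wedgeTwoTwoThree, wedgeTwoThree, s₁, s₂, h₀, h₀', hd, darboux]
    ring

/-- The six components of `ω ∧ ρ = 0` for a `3`-form with components `h`. -/
structure IsPrimitive (h : Fin 7 → Fin 7 → Fin 7 → R) : Prop where
  h136 : h 1 3 6 = -h 1 2 5
  h236 : h 2 3 6 = h 1 2 4
  h235 : h 2 3 5 = -h 1 3 4
  h346 : h 3 4 6 = -h 2 4 5
  h356 : h 3 5 6 = h 1 4 5
  h256 : h 2 5 6 = -h 1 4 6

set_option maxHeartbeats 4000000 in
theorem wedge_darboux_of_isPrimitive (h₀ : ∀ a b, h a a b = 0)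
    (h₁ : ∀ a b c, h b a c = -h a b c) (h₂ : ∀ a b c, h a c b = -h a b c)
    (hd : ∀ i j, h 0 i j = darboux R i j) (hp : IsPrimitive h) :
    wedgeTwoTwoThree (h 1) (h 1) h id =
      6 * h 1 2 3 * h 1 5 6 + 6 * h 1 2 5 * h 1 2 5 + 6 * h 1 2 6 * h 1 3 5 ∧
    wedgeTwoTwoThree (h 1) (h 2) h id =
      -6 * h 1 2 3 * h 1 4 6 - 6 * h 1 2 4 * h 1 2 5 - 6 * h 1 2 6 * h 1 3 4 ∧
    wedgeTwoTwoThree (h 1) (h 3) h id =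
      6 * h 1 2 3 * h 1 4 5 - 6 * h 1 2 4 * h 1 3 5 + 6 * h 1 2 5 * h 1 3 4 ∧
    wedgeTwoTwoThree (h 1) (h 4) h id =
      3 * h 1 2 3 * h 4 5 6 - 6 * h 1 2 5 * h 2 4 5 - 3 * h 1 2 6 * h 3 4 5
        - 3 * h 1 3 5 * h 2 4 6 + 3 * h 1 5 6 * h 2 3 4 ∧
    wedgeTwoTwoThree (h 1) (h 5) h id =
      6 * h 1 2 5 * h 1 4 5 - 6 * h 1 3 4 * h 1 5 6 + 6 * h 1 3 5 * h 1 4 6 ∧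
    wedgeTwoTwoThree (h 1) (h 6) h id =
      6 * h 1 2 4 * h 1 5 6 - 6 * h 1 2 5 * h 1 4 6 + 6 * h 1 2 6 * h 1 4 5 ∧
    wedgeTwoTwoThree (h 2) (h 2) h id =
      -6 * h 1 2 3 * h 2 4 6 + 6 * h 1 2 4 * h 1 2 4 - 6 * h 1 2 6 * h 2 3 4 ∧
    wedgeTwoTwoThree (h 2) (h 3) h id =
      6 * h 1 2 3 * h 2 4 5 + 6 * h 1 2 4 * h 1 3 4 + 6 * h 1 2 5 * h 2 3 4 ∧
    wedgeTwoTwoThree (h 2) (h 4) h id =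
      6 * h 1 2 4 * h 2 4 5 + 6 * h 1 3 4 * h 2 4 6 - 6 * h 1 4 6 * h 2 3 4 ∧
    wedgeTwoTwoThree (h 2) (h 5) h id =
      3 * h 1 2 3 * h 4 5 6 - 6 * h 1 2 4 * h 1 4 5 - 3 * h 1 2 6 * h 3 4 5
        + 3 * h 1 3 5 * h 2 4 6 - 3 * h 1 5 6 * h 2 3 4 ∧
    wedgeTwoTwoThree (h 2) (h 6) h id =
      -6 * h 1 2 4 * h 1 4 6 - 6 * h 1 2 5 * h 2 4 6 + 6 * h 1 2 6 * h 2 4 5 ∧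
    wedgeTwoTwoThree (h 3) (h 3) h id =
      6 * h 1 2 3 * h 3 4 5 + 6 * h 1 3 4 * h 1 3 4 + 6 * h 1 3 5 * h 2 3 4 ∧
    wedgeTwoTwoThree (h 3) (h 4) h id =
      6 * h 1 2 4 * h 3 4 5 - 6 * h 1 3 4 * h 2 4 5 + 6 * h 1 4 5 * h 2 3 4 ∧
    wedgeTwoTwoThree (h 3) (h 5) h id =
      6 * h 1 2 5 * h 3 4 5 - 6 * h 1 3 4 * h 1 4 5 - 6 * h 1 3 5 * h 2 4 5 ∧
    wedgeTwoTwoThree (h 3) (h 6) h id =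
      3 * h 1 2 3 * h 4 5 6 + 3 * h 1 2 6 * h 3 4 5 - 6 * h 1 3 4 * h 1 4 6
        - 3 * h 1 3 5 * h 2 4 6 - 3 * h 1 5 6 * h 2 3 4 ∧
    wedgeTwoTwoThree (h 4) (h 4) h id =
      6 * h 2 3 4 * h 4 5 6 + 6 * h 2 4 5 * h 2 4 5 + 6 * h 2 4 6 * h 3 4 5 ∧
    wedgeTwoTwoThree (h 4) (h 5) h id =
      -6 * h 1 3 4 * h 4 5 6 - 6 * h 1 4 5 * h 2 4 5 - 6 * h 1 4 6 * h 3 4 5 ∧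
    wedgeTwoTwoThree (h 4) (h 6) h id =
      6 * h 1 2 4 * h 4 5 6 - 6 * h 1 4 5 * h 2 4 6 + 6 * h 1 4 6 * h 2 4 5 ∧
    wedgeTwoTwoThree (h 5) (h 5) h id =
      -6 * h 1 3 5 * h 4 5 6 + 6 * h 1 4 5 * h 1 4 5 - 6 * h 1 5 6 * h 3 4 5 ∧
    wedgeTwoTwoThree (h 5) (h 6) h id =
      6 * h 1 2 5 * h 4 5 6 + 6 * h 1 4 5 * h 1 4 6 + 6 * h 1 5 6 * h 2 4 5 ∧
    wedgeTwoTwoThree (h 6) (h 6) h id =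
      6 * h 1 2 6 * h 4 5 6 + 6 * h 1 4 6 * h 1 4 6 + 6 * h 1 5 6 * h 2 4 6 := by
  have s₁ : ∀ a b c : Fin 7, a < b → h b a c = -h a b c := fun a b c _ => h₁ a b c
  have s₂ : ∀ a b c : Fin 7, b < c → h a c b = -h a b c := fun a b c _ => h₂ a b c
  have h₀' : ∀ a b, h a b b = 0 := fun a b => by rw [h₁, h₂, h₁, h₀]; simp
  refine ⟨?_, ?_, ?_, ?_, ?_, ?_, ?_, ?_, ?_, ?_, ?_, ?_, ?_, ?_, ?_, ?_, ?_, ?_, ?_, ?_, ?_⟩ <;>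
  · simp [wedgeTwoTwoThree, wedgeTwoThree, s₁, s₂, h₀, h₀', hd, darboux, hp.h136, hp.h236,
      hp.h235, hp.h346, hp.h356, hp.h256]
    ring

set_option maxHeartbeats 4000000 in
theorem exists_wedge_sq_eq_smul (h₀ : ∀ a b, h a a b = 0)
    (h₁ : ∀ a b c, h b a c = -h a b c) (h₂ : ∀ a b c, h a c b = -h a b c)
    (hd : ∀ i j, h 0 i j = darboux R i j) (hp : IsPrimitive h) {m : Fin 7 → Fin 7 → R}
    (hm : ∀ i j, m i j = wedgeTwoTwoThree (h i) (h j) h id) (hsymm : ∀ i j, m i j = m j i)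
    (hm₀ : ∀ i, i ≠ 0 → m 0 i = 0) :
    ∃ s : R, ∀ i j, m i 4 * m 1 j + m i 5 * m 2 j + m i 6 * m 3 j
      - m i 1 * m 4 j - m i 2 * m 5 j - m i 3 * m 6 j = s * darboux R i j := by
  have z : ∀ i, i ≠ 0 → m i 0 = 0 := fun i hi => (hsymm i 0).trans (hm₀ i hi)
  have l : ∀ i j, i < j → m j i = m i j := fun i j _ => hsymm j i
  have table := wedge_darboux_of_isPrimitive h₀ h₁ h₂ hd hp
  simp only [← hm] at table
  obtain ⟨m11, m12, m13, m14, m15, m16, m22, m23, m24, m25, m26, m33, m34, m35, m36, m44, m45,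
    m46, m55, m56, m66⟩ := table
  refine ⟨m 1 4 * m 1 4 + m 1 5 * m 2 4 + m 1 6 * m 3 4
    - m 1 1 * m 4 4 - m 1 2 * m 5 4 - m 1 3 * m 6 4, fun i j => ?_⟩
  fin_cases i <;> fin_cases j <;>
  · simp [darboux, hm₀, z, l]
    try simp only [m11, m12, m13, m14, m15, m16, m22, m23, m24, m25, m26, m33, m34, m35, m36,
      m44, m45, m46, m55, m56, m66]
    try ring

end

section

variable {k : Type*} [Field k] {V : Type*} [AddCommGroup V] [Module k V]

theorem AlternatingMap.map_vec_three_swap_left (γ : V [⋀^Fin 3]→ₗ[k] k) (a b c : V) :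
    γ ![b, a, c] = -γ ![a, b, c] := by
  rw [← γ.map_swap ![a, b, c] (show (0 : Fin 3) ≠ 1 by decide)]
  congr 1
  ext i
  fin_cases i <;> rfl

theorem AlternatingMap.map_vec_three_swap_right (γ : V [⋀^Fin 3]→ₗ[k] k) (a b c : V) :
    γ ![a, c, b] = -γ ![a, b, c] := by
  rw [← γ.map_swap ![a, b, c] (show (1 : Fin 3) ≠ 2 by decide)]
  congr 1
  ext i
  fin_cases i <;> rfl

/-- An alternating trilinear form as an iterated linear map. -/
def AlternatingMap.toTrilin (γ : V [⋀^Fin 3]→ₗ[k] k) : V →ₗ[k] V →ₗ[k] V →ₗ[k] k where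
  toFun u := LinearMap.mk₂ k (fun v x => γ ![u, v, x])
    (fun a b c => by
      rw [γ.map_vec_three_swap_left, γ.map_vecCons_add, neg_add, ← γ.map_vec_three_swap_left,
        ← γ.map_vec_three_swap_left])
    (fun r a c => by
      rw [γ.map_vec_three_swap_left, γ.map_vecCons_smul, ← smul_neg,
        ← γ.map_vec_three_swap_left])
    (fun a b c => by
      rw [γ.map_vec_three_swap_right, γ.map_vec_three_swap_left, γ.map_vecCons_add,
        γ.map_vec_three_swap_right u b a, γ.map_vec_three_swap_right u c a,
        γ.map_vec_three_swap_left b u a, γ.map_vec_three_swap_left c u a]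
      ring)
    (fun r a c => by
      rw [γ.map_vec_three_swap_right, γ.map_vec_three_swap_left, γ.map_vecCons_smul,
        γ.map_vec_three_swap_right u c a, γ.map_vec_three_swap_left c u a, neg_neg, neg_neg])
  map_add' a b := by ext; exact γ.map_vecCons_add _ a b
  map_smul' r a := by ext; exact γ.map_vecCons_smul _ r a

@[simp]
theorem AlternatingMap.toTrilin_apply (γ : V [⋀^Fin 3]→ₗ[k] k) (u v x : V) :
    γ.toTrilin u v x = γ ![u, v, x] := rfl

theorem AlternatingMap.toTrilin_swap_left (γ : V [⋀^Fin 3]→ₗ[k] k) (u v x : V) :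
    γ.toTrilin v u x = -γ.toTrilin u v x := γ.map_vec_three_swap_left u v x

theorem AlternatingMap.toTrilin_swap_right (γ : V [⋀^Fin 3]→ₗ[k] k) (u v x : V) :
    γ.toTrilin u x v = -γ.toTrilin u v x := γ.map_vec_three_swap_right u v x

theorem AlternatingMap.toTrilin_self_left (γ : V [⋀^Fin 3]→ₗ[k] k) (u x : V) :
    γ.toTrilin u u x = 0 :=
  γ.map_eq_zero_of_eq ![u, u, x] (i := 0) (j := 1) rfl (by decide)

theorem AlternatingMap.toTrilin_self_right (γ : V [⋀^Fin 3]→ₗ[k] k) (u x : V) :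
    γ.toTrilin u x x = 0 :=
  γ.map_eq_zero_of_eq ![u, x, x] (i := 1) (j := 2) rfl (by decide)

/-- The Bryant form of `γ` relative to the volume form `ω`, characterised through the expanded
wedge product. -/
def IsBryantForm (γ : V [⋀^Fin 3]→ₗ[k] k) (ω : V [⋀^Fin 7]→ₗ[k] k)
    (B : V →ₗ[k] V →ₗ[k] k) : Prop :=
  ∀ (u v : V) (x : Fin 7 → V),
    wedgeTwoTwoThree (fun a b => γ.toTrilin u a b) (fun a b => γ.toTrilin v a b)
      (fun a b c => γ.toTrilin a b c) x = -3 * B u v * ω x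

theorem isBryantForm_of_sum_perm (hchar2 : (2 : k) ≠ 0) (hchar3 : (3 : k) ≠ 0)
    (γ : V [⋀^Fin 3]→ₗ[k] k) (ω : V [⋀^Fin 7]→ₗ[k] k) (B : V →ₗ[k] V →ₗ[k] k)
    (hB : ∀ (u v : V) (x : Fin 7 → V),
      (24 : k)⁻¹ * ∑ σ : Equiv.Perm (Fin 7), ((Equiv.Perm.sign σ : ℤ) : k) *
        (γ ![u, x (σ 0), x (σ 1)] * γ ![v, x (σ 2), x (σ 3)] *
          γ ![x (σ 4), x (σ 5), x (σ 6)]) = (-3) * B u v * ω x) :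
    IsBryantForm γ ω B := by
  intro u v x
  have h24 : (24 : k) ≠ 0 := by
    have : (24 : k) = 2 ^ 3 * 3 := by norm_num
    rw [this]
    exact mul_ne_zero (pow_ne_zero _ hchar2) hchar3
  rw [← hB, ← inv_mul_cancel_left₀ h24 (wedgeTwoTwoThree _ _ _ _), ← signedSum_seven]
  · rfl
  · exact fun a b => γ.toTrilin_swap_right u a b
  · exact fun a b => γ.toTrilin_swap_right v a b
  · exact fun a b c => γ.toTrilin_swap_left a b c
  · exact fun a b c => γ.toTrilin_swap_right a b c

theorem IsBryantForm.self_eq_zero [FiniteDimensional k V] (hchar3 : (3 : k) ≠ 0)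
    (hdim : finrank k V = 7) {γ : V [⋀^Fin 3]→ₗ[k] k} {ω : V [⋀^Fin 7]→ₗ[k] k} (hω : ω ≠ 0)
    {B : V →ₗ[k] V →ₗ[k] k} (hB : IsBryantForm γ ω B) {u v : V}
    (huv : LinearIndependent k ![u, v]) (h : γ.toTrilin u v = 0) : B u u = 0 := by
  obtain ⟨e, he⟩ := exists_linearIndependent_cons_of_lt_finrank huv (by omega)
  obtain ⟨d, hd⟩ := exists_linearIndependent_cons_of_lt_finrank he (by omega)
  obtain ⟨c, hc⟩ := exists_linearIndependent_cons_of_lt_finrank hd (by omega)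
  obtain ⟨b, hb⟩ := exists_linearIndependent_cons_of_lt_finrank hc (by omega)
  obtain ⟨a, ha⟩ := exists_linearIndependent_cons_of_lt_finrank hb (by omega)
  have hx : ω ![a, b, c, d, e, u, v] ≠ 0 := by
    have := (ω.map_basis_ne_zero_iff (basisOfLinearIndependentOfCardEqFinrank ha
      (by simp [hdim]))).2 hω
    rwa [coe_basisOfLinearIndependentOfCardEqFinrank] at this
  have key := hB u u ![a, b, c, d, e, u, v]
  have l (x : V) : γ.toTrilin u v x = 0 := by rw [h]; rfl
  have r (x : V) : γ.toTrilin u x v = 0 := by rw [γ.toTrilin_swap_right, l, neg_zero]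
  have m (x : V) : γ.toTrilin x u v = 0 := by rw [γ.toTrilin_swap_left, r, neg_zero]
  have q (x : V) : γ.toTrilin u x u = 0 := by
    rw [γ.toTrilin_swap_right, γ.toTrilin_self_left, neg_zero]
  have zero : wedgeTwoTwoThree (fun a b => γ.toTrilin u a b) (fun a b => γ.toTrilin u a b)
      (fun a b c => γ.toTrilin a b c) ![a, b, c, d, e, u, v] = 0 := by
    simp [wedgeTwoTwoThree, wedgeTwoThree, -AlternatingMap.toTrilin_apply, r, m, q]
  rw [zero] at key
  simpa [hchar3, hx] using key

end

section

variable {k : Type*} [Field k] {V : Type*} [AddCommGroup V] [Module k V] [FiniteDimensional k V]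

theorem finrank_le_finrank_inf_ker_add_one (W : Submodule k V) (f : V →ₗ[k] k) :
    finrank k W ≤ finrank k (W ⊓ LinearMap.ker f : Submodule k V) + 1 := by
  have h₁ := Submodule.finrank_sup_add_finrank_inf_eq W (LinearMap.ker f)
  have h₂ := LinearMap.finrank_range_add_finrank_ker f
  have h₃ := Submodule.finrank_le (W ⊔ LinearMap.ker f)
  have h₄ : finrank k (LinearMap.range f) ≤ 1 := by
    simpa using Submodule.finrank_le (LinearMap.range f)
  omega

theorem exists_hyperbolic_pair {Ω : V →ₗ[k] V →ₗ[k] k} (hΩ : ∀ x y, Ω y x = -Ω x y)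
    (hΩ₀ : ∀ x, Ω x x = 0) {W : Submodule k V} (hW : ∀ x ∈ W, (∀ y ∈ W, Ω x y = 0) → x = 0)
    {n : ℕ} (hn : n + 2 ≤ finrank k W) :
    ∃ x ∈ W, ∃ y ∈ W, Ω x y = 1 ∧ ∃ W' ≤ W, (∀ z ∈ W', Ω x z = 0 ∧ Ω y z = 0) ∧
      (∀ z ∈ W', (∀ y ∈ W', Ω z y = 0) → z = 0) ∧ n ≤ finrank k W' := by
  have : 0 < finrank k W := by omega
  have := (Module.finrank_pos_iff (R := k)).1 this
  obtain ⟨⟨x, hx⟩, hx₀⟩ := exists_ne (0 : W)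
  obtain ⟨y, hy, hxy⟩ : ∃ y ∈ W, Ω x y ≠ 0 := by
    by_contra! h
    exact hx₀ (Subtype.ext (hW x hx h))
  refine ⟨x, hx, (Ω x y)⁻¹ • y, W.smul_mem _ hy, by simp [hxy],
    W ⊓ LinearMap.ker (Ω x) ⊓ LinearMap.ker (Ω y), inf_le_left.trans inf_le_left, ?_, ?_, ?_⟩
  · rintro z ⟨⟨-, h₁⟩, h₂⟩
    rw [SetLike.mem_coe, LinearMap.mem_ker] at h₁ h₂
    simp [h₁, h₂]
  · rintro z ⟨⟨hz, h₁⟩, h₂⟩ h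
    rw [SetLike.mem_coe, LinearMap.mem_ker] at h₁ h₂
    refine hW z hz fun v hv => ?_
    have h₁' : Ω z x = 0 := by rw [hΩ x z, h₁, neg_zero]
    have h₂' : Ω z y = 0 := by rw [hΩ y z, h₂, neg_zero]
    have := h (v - ((Ω x y)⁻¹ * Ω x v) • y + ((Ω x y)⁻¹ * Ω y v) • x) ⟨⟨W.add_mem (W.sub_mem hv
      (W.smul_mem _ hy)) (W.smul_mem _ hx), ?_⟩, ?_⟩
    · simpa [h₁', h₂'] using this
    · rw [SetLike.mem_coe, LinearMap.mem_ker]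
      simp [hΩ₀]
      field_simp
      simp
    · rw [SetLike.mem_coe, LinearMap.mem_ker]
      simp [hΩ₀, hΩ x y]
      field_simp
      simp
  · have h₁ := finrank_le_finrank_inf_ker_add_one W (Ω x)
    have h₂ := finrank_le_finrank_inf_ker_add_one (W ⊓ LinearMap.ker (Ω x)) (Ω y)
    omega

theorem exists_darboux_basis (hdim : finrank k V = 7) {Ω B : V →ₗ[k] V →ₗ[k] k}
    (hΩ : ∀ x y, Ω y x = -Ω x y) (hΩ₀ : ∀ x, Ω x x = 0) {u : V} (hu : B u u ≠ 0)
    (hΩu : Ω u = 0) (hrad : ∀ v, Ω v = 0 → ∃ c : k, v = c • u) :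
    ∃ e : Basis (Fin 7) k V, e 0 = u ∧ (∀ i, i ≠ 0 → B u (e i) = 0) ∧
      ∀ i j, Ω (e i) (e j) = darboux k i j := by
  have hΩu' (v : V) : Ω v u = 0 := by rw [hΩ, hΩu]; simp
  have hW : ∀ x ∈ LinearMap.ker (B u), (∀ y ∈ LinearMap.ker (B u), Ω x y = 0) → x = 0 := by
    intro x hx h
    rw [LinearMap.mem_ker] at hx
    obtain ⟨c, rfl⟩ := hrad x (LinearMap.ext fun v => by
      have := h (v - (B u v / B u u) • u) (by rw [LinearMap.mem_ker]; simp [hu])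
      simpa [hΩu'] using this)
    have : c = 0 := by simpa [hu] using hx
    rw [this, zero_smul]
  have hdW : 4 + 2 ≤ finrank k (LinearMap.ker (B u)) := by
    have := finrank_le_finrank_inf_ker_add_one ⊤ (B u)
    rw [top_inf_eq, finrank_top] at this
    omega
  obtain ⟨x₁, hx₁, y₁, hy₁, h₁, W₁, hW₁, o₁, hn₁, hd₁⟩ := exists_hyperbolic_pair hΩ hΩ₀ hW hdW
  obtain ⟨x₂, hx₂, y₂, hy₂, h₂, W₂, hW₂, o₂, hn₂, hd₂⟩ :=
    exists_hyperbolic_pair (n := 2) hΩ hΩ₀ hn₁ hd₁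
  obtain ⟨x₃, hx₃, y₃, hy₃, h₃, W₃, hW₃, o₃, hn₃, hd₃⟩ :=
    exists_hyperbolic_pair (n := 0) hΩ hΩ₀ hn₂ hd₂
  obtain ⟨e, he⟩ : ∃ e : Fin 7 → V, e = ![u, x₁, x₂, x₃, y₁, y₂, y₃] := ⟨_, rfl⟩
  have hBe : ∀ i, i ≠ 0 → B u (e i) = 0 := by
    intro i hi
    subst he
    fin_cases i
    · exact absurd rfl hi
    · exact hx₁
    · exact hW₁ hx₂
    · exact hW₁ (hW₂ hx₃)
    · exact hy₁
    · exact hW₁ hy₂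
    · exact hW₁ (hW₂ hy₃)
  have s₁ : ∀ z ∈ W₁, Ω z y₁ = 0 := fun z hz => by rw [hΩ, (o₁ z hz).2, neg_zero]
  have s₂ : ∀ z ∈ W₂, Ω z y₂ = 0 := fun z hz => by rw [hΩ, (o₂ z hz).2, neg_zero]
  have upper : ∀ i j, i < j → Ω (e i) (e j) = darboux k i j := by
    intro i j hij
    subst he
    fin_cases i <;> fin_cases j <;> first
      | exact absurd hij (by decide)
      | simp [darboux, hΩu, h₁, h₂, h₃, o₁ _ hx₂, o₁ _ hy₂, o₁ _ (hW₂ hx₃), o₁ _ (hW₂ hy₃),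
          o₂ _ hx₃, o₂ _ hy₃, s₁, s₂, hx₂, hW₂ hx₃, hx₃]
  have hΩe : ∀ i j, Ω (e i) (e j) = darboux k i j := by
    intro i j
    rcases lt_trichotomy i j with h | rfl | h
    · exact upper i j h
    · rw [hΩ₀]
      fin_cases i <;> simp [darboux]
    · rw [hΩ, upper j i h]
      fin_cases i <;> fin_cases j <;> simp [darboux]
  have hli : LinearIndependent k e := by
    rw [Fintype.linearIndependent_iff]
    intro g hg
    have pair (j : Fin 7) : ∑ i, g i * darboux k i j = 0 := by
      have := congr(Ω $hg (e j))
      simpa [hΩe] using this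
    have p0 : g 0 = 0 := by
      have := congr(B u $hg)
      rw [Fin.sum_univ_succ] at this
      simpa [hBe, show e 0 = u by rw [he]; rfl, hu] using this
    intro i
    fin_cases i
    · exact p0
    · simpa [Fin.sum_univ_succ, darboux] using pair 4
    · simpa [Fin.sum_univ_succ, darboux] using pair 5
    · simpa [Fin.sum_univ_succ, darboux] using pair 6
    · simpa [Fin.sum_univ_succ, darboux] using pair 1
    · simpa [Fin.sum_univ_succ, darboux] using pair 2
    · simpa [Fin.sum_univ_succ, darboux] using pair 3
  refine ⟨basisOfLinearIndependentOfCardEqFinrank hli (by simp [hdim]), ?_, ?_, ?_⟩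
  · simp [he]
  · simpa using hBe
  · simpa using hΩe

end

section

variable {k : Type*} [Field k] {V : Type*} [AddCommGroup V] [Module k V]
  {γ : V [⋀^Fin 3]→ₗ[k] k} {ω : V [⋀^Fin 7]→ₗ[k] k} {B : V →ₗ[k] V →ₗ[k] k}

theorem IsBryantForm.exists_smul_eq_of_toTrilin_eq_zero [FiniteDimensional k V]
    (hchar3 : (3 : k) ≠ 0)
    (hdim : finrank k V = 7) (hω : ω ≠ 0) (hB : IsBryantForm γ ω B) {u : V} (hu : B u u ≠ 0)
    (v : V) (hv : γ.toTrilin u v = 0) : ∃ c : k, v = c • u := by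
  by_contra! h
  refine hu (hB.self_eq_zero hchar3 hdim hω (LinearIndependent.pair_iff' ?_ |>.2 fun a ha => ?_) hv)
  · rintro rfl
    simp at hu
  · exact h a ha.symm

theorem IsBryantForm.exists_norm_map_eq [FiniteDimensional k V] (hchar3 : (3 : k) ≠ 0)
    (hdim : finrank k V = 7) (hω : ω ≠ 0) (hB : IsBryantForm γ ω B)
    (hsymm : ∀ x y, B x y = B y x) (hnondeg : ∀ x, (∀ y, B x y = 0) → x = 0) {u : V}
    (hu : B u u ≠ 0) {D : V → V} (hD : ∀ w x, B (D w) x = γ.toTrilin u w x) :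
    ∃ f : k, f ≠ 0 ∧ ∀ w, γ.toTrilin u w (D w) = f * (B u u * B w w - B u w ^ 2) := by
  obtain ⟨e, rfl, hBe, hΩe⟩ := exists_darboux_basis hdim (Ω := γ.toTrilin u) (B := B)
    (γ.toTrilin_swap_right u) (γ.toTrilin_self_right u) hu
    (LinearMap.ext (γ.toTrilin_self_left u))
    (hB.exists_smul_eq_of_toTrilin_eq_zero hchar3 hdim hω hu)
  obtain ⟨h, hh⟩ : ∃ h : Fin 7 → Fin 7 → Fin 7 → k,
    h = fun i j l => γ.toTrilin (e i) (e j) (e l) := ⟨_, rfl⟩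
  obtain ⟨m, hm⟩ : ∃ m : k, m = -3 * ω e := ⟨_, rfl⟩
  have hm₀ : m ≠ 0 := by
    rw [hm]
    exact mul_ne_zero (neg_ne_zero.2 hchar3) ((ω.map_basis_ne_zero_iff e).2 hω)
  have hwedge (i j : Fin 7) : m * B (e i) (e j) = wedgeTwoTwoThree (h i) (h j) h id := by
    rw [hh, hm, mul_right_comm]
    exact (hB (e i) (e j) e).symm
  have h₀ (a b) : h a a b = 0 := by rw [hh]; exact γ.toTrilin_self_left _ _
  have h₁ (a b c) : h b a c = -h a b c := by rw [hh]; exact γ.toTrilin_swap_left _ _ _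
  have h₂ (a b c) : h a c b = -h a b c := by rw [hh]; exact γ.toTrilin_swap_right _ _ _
  have hd (i j) : h 0 i j = darboux k i j := by rw [hh]; exact hΩe i j
  have hp : IsPrimitive h := by
    obtain ⟨-, p₁, p₂, p₃, p₄, p₅, p₆⟩ := wedge_darboux_zero h₀ h₁ h₂ hd
    rw [← hwedge, hBe _ (by decide), mul_zero] at p₁ p₂ p₃ p₄ p₅ p₆
    constructor <;> refine mul_left_cancel₀ hchar3 ?_
    · linear_combination p₁
    · linear_combination p₂
    · linear_combination -p₃
    · linear_combination -p₄
    · linear_combination -p₅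
    · linear_combination p₆
  obtain ⟨s, hs⟩ := exists_wedge_sq_eq_smul h₀ h₁ h₂ hd hp hwedge
    (fun i j => by rw [hsymm]) fun i hi => by rw [hBe i hi, mul_zero]
  have hK (v z : V) : m * (m * (B v (e 4) * B (e 1) z + B v (e 5) * B (e 2) z
      + B v (e 6) * B (e 3) z - B v (e 1) * B (e 4) z - B v (e 2) * B (e 5) z
      - B v (e 3) * B (e 6) z)) = s * γ.toTrilin (e 0) v z := by
    have : (m * m) • ((B.flip (e 4)).smulRight (B (e 1)) + (B.flip (e 5)).smulRight (B (e 2))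
        + (B.flip (e 6)).smulRight (B (e 3)) - (B.flip (e 1)).smulRight (B (e 4))
        - (B.flip (e 2)).smulRight (B (e 5)) - (B.flip (e 3)).smulRight (B (e 6))) =
        s • γ.toTrilin (e 0) := LinearMap.ext_basis e e fun i j => by
      simp only [LinearMap.smul_apply, LinearMap.sub_apply, LinearMap.add_apply,
        LinearMap.smulRight_apply, LinearMap.flip_apply, smul_eq_mul, hΩe, ← hs]
      ring
    have := LinearMap.congr_fun₂ this v z
    simp only [LinearMap.smul_apply, LinearMap.sub_apply, LinearMap.add_apply,
      LinearMap.smulRight_apply, LinearMap.flip_apply, smul_eq_mul] at this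
    rw [← this]
    ring
  have hKD (w z : V) : m ^ 2 * (B w z - B (e 0) w / B (e 0) (e 0) * B (e 0) z) =
     - s * γ.toTrilin (e 0) z (D w) := by
    obtain ⟨g, hg⟩ : ∃ g : Fin 7 → k, g = e.repr w := ⟨_, rfl⟩
    have hw : w = ∑ i, g i • e i := by rw [hg, e.sum_repr]
    have hΩw (j : Fin 7) : γ.toTrilin (e 0) w (e j) = ∑ i, g i * darboux k i j := by
      rw [hw, map_sum, LinearMap.sum_apply]
      exact Finset.sum_congr rfl fun i _ => by rw [map_smul, LinearMap.smul_apply, hΩe, smul_eq_mul]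
    have hBw : B (e 0) w = g 0 * B (e 0) (e 0) := by
      rw [hw, map_sum, Fin.sum_univ_succ]
      simp [hBe]
    have hBwz : B w z = ∑ i, g i * B (e i) z := by
      rw [hw, map_sum, LinearMap.sum_apply]
      exact Finset.sum_congr rfl fun i _ => by rw [map_smul, LinearMap.smul_apply, smul_eq_mul]
    have key := hK (D w) z
    simp only [hD, hΩw] at key
    rw [hBw, mul_div_cancel_right₀ _ hu, γ.toTrilin_swap_right _ (D w) z, neg_mul_neg, ← key, hBwz]
    simp [Fin.sum_univ_succ, darboux]
    ring
  have hs₀ : s ≠ 0 := by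
    rintro rfl
    refine e.ne_zero 1 (hnondeg _ fun z => ?_)
    have := hKD (e 1) z
    simpa [hBe, hm₀, -AlternatingMap.toTrilin_apply] using this
  refine ⟨-m ^ 2 / (s * B (e 0) (e 0)), by simp [hm₀, hs₀, hu], fun w => ?_⟩
  have := hKD w w
  field_simp at this ⊢
  linear_combination this

end

section

variable {k : Type*} [Field k]

theorem quadratic_constCoeff_eq_zero [Infinite k] {a b c a' b' c' a'' b'' c'' : k}
    (hc : c ≠ 0) (hc' : c' ≠ 0)
    (h : ∀ t : k, a + b * t + c * t ^ 2 ≠ 0 → a' + b' * t + c' * t ^ 2 ≠ 0 →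
      a'' + b'' * t + c'' * t ^ 2 = 0) : a'' = 0 := by
  let p (a b c : k) : Polynomial k :=
    Polynomial.C a + Polynomial.C b * Polynomial.X + Polynomial.C c * Polynomial.X ^ 2
  have eval (a b c t : k) : (p a b c).eval t = a + b * t + c * t ^ 2 := by simp [p]
  have ne_zero (a b c : k) (hc : c ≠ 0) : p a b c ≠ 0 := fun h => hc <| by
    simpa [p, Polynomial.coeff_X] using congr(Polynomial.coeff $h 2)
  have : p a b c * p a' b' c' * p a'' b'' c'' = 0 := Polynomial.funext fun t => by
    simp only [Polynomial.eval_mul, eval, Polynomial.eval_zero]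
    by_cases h₁ : a + b * t + c * t ^ 2 = 0
    · rw [h₁, zero_mul, zero_mul]
    by_cases h₂ : a' + b' * t + c' * t ^ 2 = 0
    · rw [h₂, mul_zero, zero_mul]
    rw [h t h₁ h₂, mul_zero]
  have : p a'' b'' c'' = 0 := by simpa [ne_zero _ _ _ hc, ne_zero _ _ _ hc'] using this
  simpa [this] using (eval a'' b'' c'' 0).symm

variable {V : Type*} [AddCommGroup V] [Module k V] [FiniteDimensional k V]
  {B : V →ₗ[k] V →ₗ[k] k}

theorem exists_orthogonal_basis_apply_self_ne_zero (hchar2 : (2 : k) ≠ 0) {n : ℕ}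
    (hdim : finrank k V = n)
    (hsymm : ∀ x y, B x y = B y x) (hnondeg : ∀ x, (∀ y, B x y = 0) → x = 0) :
    ∃ e : Basis (Fin n) k V, (∀ i j, i ≠ j → B (e i) (e j) = 0) ∧ ∀ i, B (e i) (e i) ≠ 0 := by
  subst hdim
  have := invertibleOfNonzero hchar2
  obtain ⟨e, he⟩ := LinearMap.BilinForm.exists_orthogonal_basis (B := B) ⟨hsymm⟩
  have he' : ∀ i j, i ≠ j → B (e i) (e j) = 0 := fun i j hij => he hij
  refine ⟨e, he', fun i hi => e.ne_zero i (hnondeg _ fun y => ?_)⟩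
  have : B (e i) = 0 := e.ext fun j => by
    by_cases hij : i = j
    · rw [← hij, hi]; rfl
    · exact he' i j hij
  rw [this]; rfl

theorem exists_forall_apply_eq_of_nondegenerate (hnondeg : ∀ x, (∀ y, B x y = 0) → x = 0)
    (T : V →ₗ[k] V →ₗ[k] V →ₗ[k] k) :
    ∃ D : V →ₗ[k] V →ₗ[k] V, ∀ u v x, B (D u v) x = T u v x := by
  have hinj : Function.Injective B := (injective_iff_map_eq_zero B).2 fun x hx =>
    hnondeg x fun y => by rw [hx]; rfl
  let e : V ≃ₗ[k] Dual k V := B.linearEquivOfInjective hinj Subspace.dual_finrank_eq.symm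
  refine ⟨T.compr₂ (e.symm : Dual k V →ₗ[k] V), fun u v x => ?_⟩
  exact congr($(e.apply_symm_apply (T u v)) x)

variable {γ : V [⋀^Fin 3]→ₗ[k] k} {ω : V [⋀^Fin 7]→ₗ[k] k}

theorem IsBryantForm.exists_norm_eq [Infinite k] (hchar2 : (2 : k) ≠ 0) (hchar3 : (3 : k) ≠ 0)
    (hdim : finrank k V = 7) (hω : ω ≠ 0) (hB : IsBryantForm γ ω B)
    (hsymm : ∀ x y, B x y = B y x) (hnondeg : ∀ x, (∀ y, B x y = 0) → x = 0)
    {D : V →ₗ[k] V →ₗ[k] V} (hD : ∀ u w x, B (D u w) x = γ.toTrilin u w x) :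
    ∃ f : k, ∀ v w, γ.toTrilin v w (D v w) = f * (B v v * B w w - B v w ^ 2) := by
  have key (u) (hu : B u u ≠ 0) := hB.exists_norm_map_eq hchar3 hdim hω hsymm hnondeg hu (hD u)
  have norm_symm (v w : V) : γ.toTrilin w v (D w v) = γ.toTrilin v w (D v w) := by
    rw [γ.toTrilin_swap_left, ← hD, ← hD, hsymm (D v w), hD, γ.toTrilin_swap_left, hD, neg_neg]
  obtain ⟨e, he, he'⟩ := exists_orthogonal_basis_apply_self_ne_zero hchar2 hdim hsymm hnondeg
  obtain ⟨f, -, hf⟩ := key (e 0) (he' 0)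
  refine ⟨f, fun v w => sub_eq_zero.1 ?_⟩
  refine quadratic_constCoeff_eq_zero (a := B v v) (b := 2 * B v (e 1)) (c := B (e 1) (e 1))
    (a' := B (e 0) (e 0) * B v v - B (e 0) v ^ 2)
    (b' := 2 * (B (e 0) (e 0) * B v (e 1))) (c' := B (e 0) (e 0) * B (e 1) (e 1))
    (b'' := γ.toTrilin v w (D (e 1) w) + γ.toTrilin (e 1) w (D v w)
      - f * (2 * (B v (e 1) * B w w - B v w * B (e 1) w)))
    (c'' := γ.toTrilin (e 1) w (D (e 1) w) - f * (B (e 1) (e 1) * B w w - B (e 1) w ^ 2))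
    (he' 1) (mul_ne_zero (he' 0) (he' 1)) fun t ht ht' => ?_
  have h01 : B (e 0) (e 1) = 0 := he 0 1 (by decide)
  obtain ⟨x, hx⟩ : ∃ x, x = v + t • e 1 := ⟨_, rfl⟩
  have hxx : B x x = B v v + 2 * B v (e 1) * t + B (e 1) (e 1) * t ^ 2 := by
    simp only [hx, map_add, map_smul, LinearMap.add_apply, LinearMap.smul_apply, smul_eq_mul,
      hsymm (e 1) v]
    ring
  have hx0 : B (e 0) (e 0) * B x x - B (e 0) x ^ 2 = B (e 0) (e 0) * B v v - B (e 0) v ^ 2 +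
      2 * (B (e 0) (e 0) * B v (e 1)) * t + B (e 0) (e 0) * B (e 1) (e 1) * t ^ 2 := by
    rw [hxx, hx, map_add, map_smul, h01, smul_zero, add_zero]
    ring
  rw [← hxx] at ht
  rw [← hx0] at ht'
  obtain ⟨g, -, hg⟩ := key x ht
  have hfg : f = g := by
    refine mul_right_cancel₀ ht' ?_
    rw [← hf, norm_symm x, hg, hsymm x (e 0), mul_comm (B x x)]
  have := hg w
  rw [← hfg] at this
  simp only [hx, map_add, map_smul, LinearMap.add_apply, LinearMap.smul_apply, smul_eq_mul,
      hsymm (e 1) v] at this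
  linear_combination this

theorem IsBryantForm.exists_compatible [IsAlgClosed k] (hchar2 : (2 : k) ≠ 0)
    (hchar3 : (3 : k) ≠ 0)
    (hdim : finrank k V = 7) (hω : ω ≠ 0) (hB : IsBryantForm γ ω B)
    (hsymm : ∀ x y, B x y = B y x) (hnondeg : ∀ x, (∀ y, B x y = 0) → x = 0) :
    ∃ β : V →ₗ[k] V →ₗ[k] k, (∀ u v, β u v = β v u) ∧ (∀ u, (∀ v, β u v = 0) → u = 0) ∧
      ∀ u v, ∃ d, (∀ x, β d x = γ ![u, v, x]) ∧
        2 * γ ![u, v, d] = β u u * β v v - β u v ^ 2 := by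
  have := IsAlgClosed.instInfinite (K := k)
  obtain ⟨D, hD⟩ := exists_forall_apply_eq_of_nondegenerate hnondeg γ.toTrilin
  obtain ⟨f, hf⟩ := hB.exists_norm_eq hchar2 hchar3 hdim hω hsymm hnondeg hD
  have hf₀ : f ≠ 0 := by
    rintro rfl
    obtain ⟨e, he, he'⟩ := exists_orthogonal_basis_apply_self_ne_zero hchar2 hdim hsymm hnondeg
    obtain ⟨g, hg, hg'⟩ := hB.exists_norm_map_eq hchar3 hdim hω hsymm hnondeg (he' 0) (hD (e 0))
    have := (hf _ _).symm.trans (hg' (e 1))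
    simp [hg, he', he 0 1 (by decide)] at this
  obtain ⟨c, hc⟩ := IsAlgClosed.exists_pow_nat_eq (2 * f) (n := 3) (by norm_num)
  have hc₀ : c ≠ 0 := by
    rintro rfl
    simp [hchar2, hf₀] at hc
  refine ⟨c • B, fun u v => by simp [hsymm u v], fun u hu => hnondeg u fun v => ?_, fun u v =>
    ⟨c⁻¹ • D u v, fun x => ?_, ?_⟩⟩
  · simpa [hc₀] using hu v
  · simp [hc₀, hD]
  · have := hf u v
    rw [← γ.toTrilin_apply, map_smul, this]
    simp only [LinearMap.smul_apply, smul_eq_mul]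
    field_simp
    linear_combination -(B u u * B v v - B u v ^ 2) * hc

end

section

variable {k : Type*} [Field k] {V : Type*} [AddCommGroup V] [Module k V]

theorem two_mul_apply_cross_cross {γ : V [⋀^Fin 3]→ₗ[k] k} {β : V →ₗ[k] V →ₗ[k] k}
    {D : V →ₗ[k] V →ₗ[k] V} (hchar2 : (2 : k) ≠ 0) (hsymm : ∀ x y, β x y = β y x)
    (hD : ∀ u v x, β (D u v) x = γ.toTrilin u v x)
    (hcomp : ∀ u v, 2 * γ.toTrilin u v (D u v) = β u u * β v v - β u v ^ 2) (u v w : V) :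
    2 * β (D u v) (D u w) = β u u * β v w - β u v * β u w := by
  have h₁ := hcomp u (v + w)
  have h₂ := hcomp u v
  have h₃ := hcomp u w
  rw [← hD] at h₁ h₂ h₃
  simp only [map_add, LinearMap.add_apply, hsymm w v, hsymm (D u w) (D u v)] at h₁
  refine mul_left_cancel₀ hchar2 ?_
  linear_combination h₁ - h₂ - h₃

variable [FiniteDimensional k V]

theorem exists_eq_smul_of_isotropic_imp_isotropic [IsAlgClosed k] (hchar2 : (2 : k) ≠ 0)
    {β B : V →ₗ[k] V →ₗ[k] k} (hβsymm : ∀ x y, β x y = β y x)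
    (hβ : ∀ x, (∀ y, β x y = 0) → x = 0) (hB : ∀ x y, B x y = B y x)
    (h : ∀ x, β x x = 0 → B x x = 0) : ∃ c : k, B = c • β := by
  obtain ⟨e, he, he'⟩ := exists_orthogonal_basis_apply_self_ne_zero hchar2 rfl hβsymm hβ
  have key (i j) (hij : i ≠ j) : B (e i) (e j) = 0 ∧
      B (e i) (e i) * β (e j) (e j) = B (e j) (e j) * β (e i) (e i) := by
    obtain ⟨t, ht⟩ := IsAlgClosed.exists_pow_nat_eq (-(β (e i) (e i) / β (e j) (e j)))
      (n := 2) (by norm_num)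
    have hta : t ^ 2 * β (e j) (e j) = -β (e i) (e i) := by
      rw [ht]
      field_simp [he' j]
    have ht₀ : t ≠ 0 := by
      rintro rfl
      simp [he'] at hta
    have isotropic (s : k) (hs : s ^ 2 = t ^ 2) :
        B (e i) (e i) + 2 * s * B (e i) (e j) + s ^ 2 * B (e j) (e j) = 0 := by
      have := h (e i + s • e j) (by
        simp only [map_add, map_smul, LinearMap.add_apply, LinearMap.smul_apply, smul_eq_mul,
          he i j hij, he j i hij.symm]
        linear_combination hs * β (e j) (e j) + hta)
      simp only [map_add, map_smul, LinearMap.add_apply, LinearMap.smul_apply, smul_eq_mul,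
        hB (e j) (e i)] at this
      linear_combination this
    have h₁ := isotropic t rfl
    have h₂ := isotropic (-t) (by ring)
    constructor
    · refine mul_left_cancel₀ (mul_ne_zero (mul_ne_zero hchar2 hchar2) ht₀) ?_
      linear_combination h₁ - h₂
    · refine mul_left_cancel₀ hchar2 ?_
      linear_combination (h₁ + h₂) * β (e j) (e j) - 2 * B (e j) (e j) * hta
  rcases isEmpty_or_nonempty (Fin (finrank k V)) with hE | ⟨⟨i₀⟩⟩
  · exact ⟨0, e.ext fun i => hE.elim i⟩
  refine ⟨B (e i₀) (e i₀) / β (e i₀) (e i₀), LinearMap.ext_basis e e fun i j => ?_⟩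
  rw [LinearMap.smul_apply, LinearMap.smul_apply, smul_eq_mul]
  by_cases hij : i = j
  · subst hij
    by_cases hi : i = i₀
    · rw [hi, div_mul_cancel₀ _ (he' i₀)]
    · have := (key i i₀ hi).2
      have := he' i₀
      field_simp
      assumption
  · rw [he i j hij, (key i j hij).1, mul_zero]

variable {γ : V [⋀^Fin 3]→ₗ[k] k} {ω : V [⋀^Fin 7]→ₗ[k] k} {β B : V →ₗ[k] V →ₗ[k] k}
  {D : V →ₗ[k] V →ₗ[k] V}

theorem IsBryantForm.self_ne_zero_of_compatible (hchar2 : (2 : k) ≠ 0) (hchar3 : (3 : k) ≠ 0)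
    (hdim : finrank k V = 7) (hB : IsBryantForm γ ω B) (hsymm : ∀ x y, β x y = β y x)
    (hβ : ∀ x, (∀ y, β x y = 0) → x = 0) (hD : ∀ u v x, β (D u v) x = γ.toTrilin u v x)
    (hcomp : ∀ u v, 2 * γ.toTrilin u v (D u v) = β u u * β v v - β u v ^ 2) {u : V}
    (hu : β u u ≠ 0) : B u u ≠ 0 := by
  have hrad (v : V) (hv : γ.toTrilin u v = 0) : ∃ c : k, v = c • u := by
    have hDv : D u v = 0 := hβ _ fun y => by rw [hD, hv]; rfl
    refine ⟨β u v / β u u, sub_eq_zero.1 (hβ _ fun w => ?_)⟩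
    have := two_mul_apply_cross_cross hchar2 hsymm hD hcomp u v w
    rw [hDv, map_zero, LinearMap.zero_apply, mul_zero] at this
    simp only [map_sub, map_smul, LinearMap.sub_apply, LinearMap.smul_apply, smul_eq_mul]
    field_simp
    linear_combination -this
  obtain ⟨e, rfl, -, hΩe⟩ := exists_darboux_basis hdim (Ω := γ.toTrilin u) (B := β)
    (γ.toTrilin_swap_right u) (γ.toTrilin_self_right u) hu
    (LinearMap.ext (γ.toTrilin_self_left u)) hrad
  intro h
  have h₁ := (wedge_darboux_zero (h := fun i j l => γ.toTrilin (e i) (e j) (e l))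
    (fun _ _ => γ.toTrilin_self_left _ _) (fun _ _ _ => γ.toTrilin_swap_left _ _ _)
    (fun _ _ _ => γ.toTrilin_swap_right _ _ _) hΩe).1
  have h₂ := h₁.symm.trans (hB (e 0) (e 0) e)
  rw [h, mul_zero, zero_mul] at h₂
  exact mul_ne_zero hchar2 hchar3 (by linear_combination -h₂)

theorem IsBryantForm.self_eq_zero_of_compatible (hchar2 : (2 : k) ≠ 0) (hchar3 : (3 : k) ≠ 0)
    (hdim : finrank k V = 7) (hω : ω ≠ 0) (hB : IsBryantForm γ ω B)
    (hsymm : ∀ x y, β x y = β y x)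
    (hβ : ∀ x, (∀ y, β x y = 0) → x = 0) (hD : ∀ u v x, β (D u v) x = γ.toTrilin u v x)
    (hcomp : ∀ u v, 2 * γ.toTrilin u v (D u v) = β u u * β v v - β u v ^ 2) {u : V}
    (hu : β u u = 0) : B u u = 0 := by
  by_contra hBu
  have hrad := hB.exists_smul_eq_of_toTrilin_eq_zero hchar3 hdim hω hBu
  have hu₀ : u ≠ 0 := by
    rintro rfl
    simp at hBu
  obtain ⟨y, hy⟩ : ∃ y, β u y ≠ 0 := by
    by_contra! h
    exact hu₀ (hβ u h)
  have cross_eq_smul (v : V) (hv : β u v = 0) : ∃ c : k, D u v = c • u := by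
    refine hrad _ (LinearMap.ext fun x => ?_)
    have := two_mul_apply_cross_cross hchar2 hsymm hD hcomp u x v
    rw [hu, hv, zero_mul, mul_zero, sub_zero, hD, γ.toTrilin_swap_right] at this
    simpa [hchar2, -AlternatingMap.toTrilin_apply] using this
  have hle : ⊤ ⊓ LinearMap.ker (β u) ⊓ LinearMap.ker (β y ∘ₗ D u) ≤ Submodule.span k {u} := by
    rintro v ⟨⟨-, h₁⟩, h₂⟩
    rw [SetLike.mem_coe, LinearMap.mem_ker] at h₁ h₂
    obtain ⟨c, hc⟩ := cross_eq_smul v h₁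
    have hc₀ : c = 0 := by
      rw [LinearMap.comp_apply, hc, map_smul, hsymm y u, smul_eq_mul] at h₂
      exact (mul_eq_zero.1 h₂).resolve_right hy
    rw [hc₀, zero_smul] at hc
    obtain ⟨d, rfl⟩ := hrad v (LinearMap.ext fun x => by rw [← hD, hc, map_zero])
    exact Submodule.smul_mem _ _ (Submodule.mem_span_singleton_self u)
  have h₁ := Submodule.finrank_mono hle
  have h₂ := finrank_le_finrank_inf_ker_add_one ⊤ (β u)
  have h₃ := finrank_le_finrank_inf_ker_add_one (⊤ ⊓ LinearMap.ker (β u)) (β y ∘ₗ D u)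
  rw [finrank_top] at h₂
  rw [finrank_span_singleton hu₀] at h₁
  omega

theorem IsBryantForm.nondegenerate_of_compatible [IsAlgClosed k] (hchar2 : (2 : k) ≠ 0)
    (hchar3 : (3 : k) ≠ 0) (hdim : finrank k V = 7) (hω : ω ≠ 0) (hB : IsBryantForm γ ω B)
    (hBsymm : ∀ x y, B x y = B y x) (hsymm : ∀ x y, β x y = β y x)
    (hβ : ∀ x, (∀ y, β x y = 0) → x = 0)
    (hcomp : ∀ u v, ∃ d, (∀ x, β d x = γ ![u, v, x]) ∧
      2 * γ ![u, v, d] = β u u * β v v - β u v ^ 2) (u : V) (hu : ∀ v, B u v = 0) : u = 0 := by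
  obtain ⟨D, hD⟩ := exists_forall_apply_eq_of_nondegenerate hβ γ.toTrilin
  have hcomp' (u v : V) : 2 * γ.toTrilin u v (D u v) = β u u * β v v - β u v ^ 2 := by
    obtain ⟨d, hd, h⟩ := hcomp u v
    have : D u v = d := sub_eq_zero.1 <| hβ _ fun x => by
      rw [map_sub, LinearMap.sub_apply, hD, hd, γ.toTrilin_apply, sub_self]
    rw [this]
    exact h
  obtain ⟨c, rfl⟩ := exists_eq_smul_of_isotropic_imp_isotropic hchar2 hsymm hβ hBsymm fun _ =>
    hB.self_eq_zero_of_compatible hchar2 hchar3 hdim hω hsymm hβ hD hcomp'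
  obtain ⟨e, -, he⟩ := exists_orthogonal_basis_apply_self_ne_zero hchar2 hdim hsymm hβ
  have hc := hB.self_ne_zero_of_compatible hchar2 hchar3 hdim hsymm hβ hD hcomp' (he 0)
  refine hβ u fun v => (mul_eq_zero.1 (hu v)).resolve_left ?_
  rintro rfl
  simp at hc

end

/-- For a 7-dimensional space `V` over an algebraically closed field of
characteristic not `2` or `3`, an alternating trilinear form `γ` is nondegenerate
(admits a compatible nondegenerate symmetric bilinear form) iff the Bryant form `β_γ`,
defined by `(ι_u γ) ∧ (ι_v γ) ∧ γ = −3 β_γ(u,v) ω`, is nondegenerate.  The triple wedge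
product of the two `2`-forms and the `3`-form is written out as the alternating sum
`(1/(2!·2!·3!)) Σ_{σ ∈ S₇} sgn(σ) (ι_u γ)(x_{σ1},x_{σ2}) (ι_v γ)(x_{σ3},x_{σ4}) γ(x_{σ5},x_{σ6},x_{σ7})`. -/
theorem nondegenerate_iff_bryantForm_nondegenerate
    {k : Type*} [Field k] [IsAlgClosed k] (hchar2 : (2 : k) ≠ 0) (hchar3 : (3 : k) ≠ 0)
    {V : Type*} [AddCommGroup V] [Module k V] [FiniteDimensional k V]
    (hdim : finrank k V = 7)
    (γ : V [⋀^Fin 3]→ₗ[k] k)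
    (ω : V [⋀^Fin 7]→ₗ[k] k) (hω : ω ≠ 0)
    (βγ : V →ₗ[k] V →ₗ[k] k)
    (hβγsymm : ∀ u v : V, βγ u v = βγ v u)
    (hβγdef : ∀ (u v : V) (x : Fin 7 → V),
      (24 : k)⁻¹ * ∑ σ : Equiv.Perm (Fin 7),
          ((Equiv.Perm.sign σ : ℤ) : k) *
            (γ ![u, x (σ 0), x (σ 1)] * γ ![v, x (σ 2), x (σ 3)] *
              γ ![x (σ 4), x (σ 5), x (σ 6)])
        = (-3) * βγ u v * ω x) :
    (∃ β : V →ₗ[k] V →ₗ[k] k,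
        (∀ u v : V, β u v = β v u) ∧
        (∀ u : V, (∀ v : V, β u v = 0) → u = 0) ∧
        (∀ u v : V, ∃ d : V, (∀ x : V, β d x = γ ![u, v, x]) ∧
          2 * γ ![u, v, d] = β u u * β v v - (β u v) ^ 2)) ↔
      (∀ u : V, (∀ v : V, βγ u v = 0) → u = 0) := by
  have hB := isBryantForm_of_sum_perm hchar2 hchar3 γ ω βγ hβγdef
  constructor
  · rintro ⟨β, hsymm, hβ, hcomp⟩
    exact hB.nondegenerate_of_compatible hchar2 hchar3 hdim hω hβγsymm hsymm hβ hcomp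
  · exact hB.exists_compatible hchar2 hchar3 hdim hω hβγsymm
end

section
/- Let k be an algebraically closed field with char k ≠ 2, V a 7-dimensional k-vector space, γ a nondegenerate alternating trilinear form on V, and β a nondegenerate symmetric bilinear form compatible with γ. Let u ∈ V be a nonzero γ-isotropic vector, and set E_u = {v ∈ V : γ(u, v, x) = 0 for all x ∈ V}. Then: (i) dim E_u = 3; (ii) β vanishes identically on E_u (E_u is β-isotropic); and (iii) every 2-dimensional γ-isotropic subspace of V contained in E_u contains u. -/
open Module

section CrossProduct

variable {k V : Type*} [Field k] [AddCommGroup V] [Module k V]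

theorem AlternatingMap.exists_crossProduct (γ : V [⋀^Fin 3]→ₗ[k] k) (β : V →ₗ[k] V →ₗ[k] k)
    (hβnd : ∀ u : V, (∀ v : V, β u v = 0) → u = 0)
    (hγ : ∀ u v : V, ∃ d : V, ∀ x : V, β d x = γ ![u, v, x]) :
    ∃ c : V →ₗ[k] V →ₗ[k] V, ∀ u v x : V, β (c u v) x = γ ![u, v, x] := by
  choose d hd using hγ
  have ext : ∀ a b : V, (∀ x, β a x = β b x) → a = b := fun a b h =>
    sub_eq_zero.1 (hβnd _ fun v => by rw [map_sub, LinearMap.sub_apply, h, sub_self])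
  have swap : ∀ a b x : V, γ ![a, b, x] = -γ ![b, a, x] := fun a b x => by
    rw [← γ.map_swap ![b, a, x] (show (0 : Fin 3) ≠ 1 by decide)]
    congr 1
    ext i
    fin_cases i <;> rfl
  have add : ∀ a b v x : V, γ ![a + b, v, x] = γ ![a, v, x] + γ ![b, v, x] := fun a b v x =>
    γ.toMultilinearMap.cons_add ![v, x] a b
  have smul : ∀ (r : k) (a v x : V), γ ![r • a, v, x] = r • γ ![a, v, x] := fun r a v x =>
    γ.toMultilinearMap.cons_smul ![v, x] r a
  refine ⟨LinearMap.mk₂ k d ?_ ?_ ?_ ?_, fun u v x => hd u v x⟩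
  · intro a b v
    exact ext _ _ fun x => by simp [hd, add]
  · intro r a v
    exact ext _ _ fun x => by simp [hd, smul]
  · intro v a b
    refine ext _ _ fun x => ?_
    rw [hd, swap, add, map_add, LinearMap.add_apply, hd, hd, swap v a, swap v b]
    ring
  · intro r v a
    refine ext _ _ fun x => ?_
    rw [hd, swap, smul, map_smul, LinearMap.smul_apply, hd, swap v a, smul_neg]

variable {β : V →ₗ[k] V →ₗ[k] k} {c : V →ₗ[k] V →ₗ[k] V}

theorem two_smul_cross_cross_self (hβsymm : ∀ u v : V, β u v = β v u)
    (hβnd : ∀ u : V, (∀ v : V, β u v = 0) → u = 0)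
    (hskew : ∀ u x y : V, β (c u x) y = -β (c u y) x)
    (hnorm : ∀ u v : V, 2 * β (c u v) (c u v) = β u u * β v v - β u v ^ 2)
    (hchar : (2 : k) ≠ 0) (u v : V) :
    (2 : k) • c u (c u v) = β u v • u - β u u • v := by
  refine sub_eq_zero.1 (hβnd _ fun w => ?_)
  have h₁ := hnorm u v
  have h₂ := hnorm u w
  have h₃ := hnorm u (v + w)
  simp only [map_add, LinearMap.add_apply] at h₃
  have h₄ := hβsymm (c u w) (c u v)
  have h₅ := hβsymm w v
  have h₆ := hskew u (c u v) w
  simp only [map_sub, map_smul, LinearMap.sub_apply, LinearMap.smul_apply, smul_eq_mul]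
  rw [h₄, h₅] at h₃
  rw [h₆, h₄]
  refine mul_left_cancel₀ hchar ?_
  linear_combination h₁ + h₂ - h₃

theorem two_smul_cross_cross_add (hβsymm : ∀ u v : V, β u v = β v u)
    (hdouble : ∀ u v : V, (2 : k) • c u (c u v) = β u v • u - β u u • v) (u w v : V) :
    (2 : k) • (c u (c w v) + c w (c u v)) = β u v • w + β w v • u - (2 * β u w) • v := by
  have h₁ := hdouble u v
  have h₂ := hdouble w v
  have h₃ := hdouble (u + w) v
  simp only [map_add, LinearMap.add_apply] at h₃
  rw [hβsymm w u] at h₃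
  linear_combination (norm := module) h₃ - h₁ - h₂

end CrossProduct

/-- For a nondegenerate alternating trilinear form `γ` with compatible
nondegenerate symmetric bilinear form `β` on a 7-dimensional space `V`, and a nonzero
`γ`-isotropic vector `u`, the set `E_u = {v | γ(u,v,·) ≡ 0}` is a 3-dimensional
`β`-isotropic subspace, and every 2-dimensional `γ`-isotropic subspace contained in
`E_u` contains `u`. -/
theorem eSpace_dim_three_isotropic
    {k : Type*} [Field k] [IsAlgClosed k] (hchar : (2 : k) ≠ 0)
    {V : Type*} [AddCommGroup V] [Module k V] [FiniteDimensional k V]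
    (hdim : finrank k V = 7)
    (β : V →ₗ[k] V →ₗ[k] k)
    (hβsymm : ∀ u v : V, β u v = β v u)
    (hβnd : ∀ u : V, (∀ v : V, β u v = 0) → u = 0)
    (γ : V [⋀^Fin 3]→ₗ[k] k)
    (hcompat : ∀ u v : V, ∃ d : V, (∀ x : V, β d x = γ ![u, v, x]) ∧
      2 * γ ![u, v, d] = β u u * β v v - (β u v) ^ 2)
    (u : V) (hu : u ≠ 0)
    (huiso : ∃ W : Submodule k V, finrank k W = 2 ∧
      (∀ a ∈ W, ∀ b ∈ W, ∀ x : V, γ ![a, b, x] = 0) ∧ u ∈ W) :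
    (∃ E : Submodule k V,
        (E : Set V) = {v : V | ∀ x : V, γ ![u, v, x] = 0} ∧ finrank k E = 3) ∧
      (∀ v : V, (∀ x : V, γ ![u, v, x] = 0) →
        ∀ w : V, (∀ x : V, γ ![u, w, x] = 0) → β v w = 0) ∧
      (∀ W : Submodule k V, finrank k W = 2 →
        (∀ a ∈ W, ∀ b ∈ W, ∀ x : V, γ ![a, b, x] = 0) →
        (W : Set V) ⊆ {v : V | ∀ x : V, γ ![u, v, x] = 0} → u ∈ W) := by
  obtain ⟨c, hc⟩ := γ.exists_crossProduct β hβnd fun u v => (hcompat u v).imp fun _ h => h.1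
  have ext : ∀ a b : V, (∀ x, β a x = β b x) → a = b := fun a b h =>
    sub_eq_zero.1 (hβnd _ fun v => by rw [map_sub, LinearMap.sub_apply, h, sub_self])
  have hanti : ∀ a b : V, c a b = -c b a := fun a b => ext _ _ fun x => by
    rw [map_neg, LinearMap.neg_apply, hc, hc,
      ← γ.map_swap ![b, a, x] (show (0 : Fin 3) ≠ 1 by decide)]
    congr 1
    ext i
    fin_cases i <;> rfl
  have hself : ∀ a : V, c a a = 0 := fun a => hβnd _ fun x => by
    rw [hc]
    exact γ.map_eq_zero_of_eq _ (show ![a, a, x] 0 = ![a, a, x] 1 from rfl) (by decide)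
  have hskew : ∀ a x y : V, β (c a x) y = -β (c a y) x := fun a x y => by
    rw [hc, hc, ← γ.map_swap ![a, y, x] (show (1 : Fin 3) ≠ 2 by decide)]
    congr 1
    ext i
    fin_cases i <;> rfl
  have hnorm : ∀ a b : V, 2 * β (c a b) (c a b) = β a a * β b b - β a b ^ 2 := fun a b => by
    obtain ⟨d, hd, hd'⟩ := hcompat a b
    rw [← hd', ext d (c a b) fun x => by rw [hd, hc], hc]
  have hdouble := two_smul_cross_cross_self hβsymm hβnd hskew hnorm hchar
  have hlin := two_smul_cross_cross_add hβsymm hdouble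
  have hmem : ∀ a v : V, (∀ x : V, γ ![a, v, x] = 0) ↔ c a v = 0 := fun a v =>
    ⟨fun h => hβnd _ fun x => by rw [hc, h], fun h x => by rw [← hc, h]; simp⟩
  simp only [hmem] at huiso ⊢
  have huu : β u u = 0 := by
    obtain ⟨W, hW, hWiso, huW⟩ := huiso
    by_contra h
    have hle : W ≤ Submodule.span k {u} := fun w hw => by
      have h₁ := hdouble u w
      rw [hWiso u huW w hw, map_zero, smul_zero] at h₁
      refine Submodule.mem_span_singleton.2 ⟨(β u u)⁻¹ * β u w, ?_⟩
      rw [mul_smul, sub_eq_zero.1 h₁.symm, inv_smul_smul₀ h]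
    have h₂ := Submodule.finrank_mono hle
    rw [hW, finrank_span_singleton hu] at h₂
    omega
  have horth : ∀ v, c u v = 0 → β u v = 0 := fun v hv => by
    have h₁ := hdouble u v
    rw [hv, map_zero, smul_zero, huu, zero_smul, sub_zero] at h₁
    exact (smul_eq_zero.1 h₁.symm).resolve_right hu
  have hnull : ∀ v, c u v = 0 → β v v = 0 := fun v hv => by
    have h₁ := hlin u v v
    rw [hself, hv, map_zero, map_zero, add_zero, smul_zero, horth v hv] at h₁
    simpa [hu] using h₁.symm
  have hiso : ∀ v, c u v = 0 → ∀ w, c u w = 0 → β v w = 0 := fun v hv w hw => by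
    have h₁ := hnull (v + w) (by rw [map_add, hv, hw, add_zero])
    simp only [map_add, LinearMap.add_apply, hnull v hv, hnull w hw, hβsymm w v] at h₁
    refine (mul_eq_zero.1 (?_ : 2 * β v w = 0)).resolve_left hchar
    linear_combination h₁
  have hker : finrank k (LinearMap.ker (c u)) = 3 := by
    have hβinj : Function.Injective β :=
      (injective_iff_map_eq_zero β).2 fun a ha => hβnd a fun v => by rw [ha]; rfl
    apply le_antisymm
    · have h₁ : (LinearMap.ker (c u)).map β ≤ (LinearMap.ker (c u)).dualAnnihilator := by
        rintro _ ⟨v, hv, rfl⟩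
        exact (Submodule.mem_dualAnnihilator _).2 fun w hw => hiso v hv w hw
      have h₂ := ((LinearMap.ker (c u)).equivMapOfInjective β hβinj).finrank_eq.trans_le
        (Submodule.finrank_mono h₁)
      have h₃ := (Nat.add_le_add_left h₂ (finrank k (LinearMap.ker (c u)))).trans_eq
        (Subspace.finrank_add_finrank_dualAnnihilator_eq (LinearMap.ker (c u)))
      omega
    · have h₁ : (LinearMap.ker (β u)).map (c u) ≤ LinearMap.ker (c u) := by
        rintro _ ⟨v, hv, rfl⟩
        have h := hdouble u v
        rw [LinearMap.mem_ker.1 hv, huu, zero_smul, zero_smul, sub_zero] at h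
        exact (smul_eq_zero.1 h).resolve_left hchar
      have h₂ := Submodule.finrank_mono h₁
      have h₃ := LinearMap.finrank_range_add_finrank_ker ((c u).domRestrict (LinearMap.ker (β u)))
      have h₄ := LinearMap.finrank_range_add_finrank_ker (β u)
      have h₅ : finrank k (LinearMap.range (β u)) ≤ 1 :=
        (Submodule.finrank_le _).trans (finrank_self k).le
      have h₆ : finrank k (LinearMap.ker ((c u).domRestrict (LinearMap.ker (β u)))) ≤
          finrank k (LinearMap.ker (c u)) := by
        rw [LinearMap.ker_domRestrict, ← Submodule.finrank_map_subtype_eq]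
        exact Submodule.finrank_mono (Submodule.map_comap_le _ _)
      rw [LinearMap.range_domRestrict] at h₃
      omega
  refine ⟨⟨LinearMap.ker (c u), Set.ext fun v => LinearMap.mem_ker, hker⟩, hiso, ?_⟩
  intro W hW hWiso hWE
  by_contra huW
  have hsup : W ⊔ Submodule.span k {u} = LinearMap.ker (c u) := by
    apply Submodule.eq_of_le_of_finrank_eq
    · exact sup_le (fun w hw => hWE hw) ((Submodule.span_singleton_le_iff_mem _ _).2 (hself u))
    · have h₁ := Submodule.finrank_sup_add_finrank_inf_eq W (Submodule.span k {u})
      rw [((Submodule.disjoint_span_singleton' hu).2 huW).eq_bot, finrank_bot,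
        finrank_span_singleton hu, hW] at h₁
      omega
  have hprod : ∀ a ∈ W, ∀ b, c u b = 0 → c a b = 0 := fun a ha b hb => by
    obtain ⟨w, hw, s, hs, rfl⟩ := Submodule.mem_sup.1 (hsup.symm ▸ LinearMap.mem_ker.2 hb)
    obtain ⟨r, rfl⟩ := Submodule.mem_span_singleton.1 hs
    have hua : c u a = 0 := hWE ha
    rw [map_add, hWiso a ha w hw, map_smul, hanti, hua]
    simp
  have hperp : ∀ a ∈ W, ∀ z, β u z = 0 → β a z = 0 := fun a ha z hz => by
    have hua : c u a = 0 := hWE ha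
    have h₁ := hdouble u z
    rw [hz, huu, zero_smul, zero_smul, sub_zero] at h₁
    have h₂ := hprod a ha _ ((smul_eq_zero.1 h₁).resolve_left hchar)
    have h₃ := hlin a z u
    rw [hanti z u, map_neg, h₂, hanti a u, hua, hβsymm a u, horth a hua, hβsymm z u, hz] at h₃
    simpa [hu, hchar] using h₃
  obtain ⟨p, hp⟩ : ∃ p, β u p ≠ 0 := by
    by_contra! h
    exact hu (hβnd u h)
  have hle : W ≤ Submodule.span k {u} := fun a ha => by
    refine Submodule.mem_span_singleton.2 ⟨β a p / β u p, ext _ _ fun x => ?_⟩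
    have h₁ := hperp a ha (x - (β u x / β u p) • p) (by simp [hp])
    simp only [map_sub, map_smul, smul_eq_mul] at h₁
    simp only [map_smul, LinearMap.smul_apply, smul_eq_mul]
    linear_combination -h₁
  have h₂ := Submodule.finrank_mono hle
  rw [hW, finrank_span_singleton hu] at h₂
  omega
end

section
/- Let C be an octonion algebra (8-dimensional composition algebra) over an algebraically closed field k with char k ≠ 2, with identity e, norm N, imaginary subspace V = e⊥, and associated forms β and γ on V. Let u ∈ V be a nonzero vector with N(u) = 0. Then the set E_u = {v ∈ V : u·v = 0} is a linear subspace of V equal to {v ∈ V : γ(u, v, x) = 0 for all x ∈ V}, it has dimension 3, and N vanishes on E_u (equivalently, β vanishes identically on E_u). -/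
open Module

section CompositionAlgebra

variable {k : Type*} [Field k] {C : Type*} [AddCommGroup C] [Module k C]
  {mul : C →ₗ[k] C →ₗ[k] C} {e : C} {N : QuadraticForm k C}

theorem polar_mul_left (hNmul : ∀ x y : C, N (mul x y) = N x * N y) (x y z : C) :
    N.polarBilin (mul x y) (mul x z) = N x * N.polarBilin y z := by
  have h := hNmul x (y + z)
  simp only [QuadraticMap.polarBilin_apply_apply, QuadraticMap.polar, map_add] at h ⊢
  rw [h, hNmul, hNmul]
  ring

theorem polar_mul_add_polar_mul (hNmul : ∀ x y : C, N (mul x y) = N x * N y) (x w y z : C) :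
    N.polarBilin (mul x y) (mul w z) + N.polarBilin (mul w y) (mul x z) =
      N.polarBilin x w * N.polarBilin y z := by
  have h := polar_mul_left hNmul (x + w) y z
  have hx := polar_mul_left hNmul x y z
  have hw := polar_mul_left hNmul w y z
  have hp : N.polarBilin x w = N (x + w) - N x - N w := rfl
  simp only [map_add, LinearMap.add_apply] at h
  rw [hp]
  linear_combination h - hx - hw

/-- Left multiplication by an imaginary element is skew-adjoint. -/
theorem polar_mul_skew (he₁ : ∀ x : C, mul e x = x)
    (hNmul : ∀ x y : C, N (mul x y) = N x * N y) {u : C} (hu : N.polarBilin u e = 0) (y z : C) :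
    N.polarBilin (mul u y) z = -N.polarBilin y (mul u z) := by
  have h := polar_mul_add_polar_mul hNmul u e y z
  rw [he₁, he₁, hu] at h
  linear_combination h

theorem mul_mul_eq_zero (he₁ : ∀ x : C, mul e x = x)
    (hNnd : ∀ x : C, (∀ y : C, N.polarBilin x y = 0) → x = 0)
    (hNmul : ∀ x y : C, N (mul x y) = N x * N y) {u : C} (hu : N.polarBilin u e = 0)
    (huN : N u = 0) (y : C) : mul u (mul u y) = 0 := by
  refine hNnd _ fun z => ?_
  rw [polar_mul_skew he₁ hNmul hu, polar_mul_left hNmul, huN, zero_mul, neg_zero]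

theorem mul_mul_eq_neg_smul (he₁ : ∀ x : C, mul e x = x)
    (hNnd : ∀ x : C, (∀ y : C, N.polarBilin x y = 0) → x = 0)
    (hNmul : ∀ x y : C, N (mul x y) = N x * N y) {u : C} (hu : N.polarBilin u e = 0)
    (y : C) {z : C} (hz : mul u z = 0) :
    mul u (mul y z) = -(N.polarBilin y u • z) := by
  refine eq_neg_of_add_eq_zero_left (hNnd _ fun t => ?_)
  have h := polar_mul_add_polar_mul hNmul y u z t
  rw [hz, map_zero, LinearMap.zero_apply, add_zero] at h
  rw [map_add, LinearMap.add_apply, polar_mul_skew he₁ hNmul hu, h, map_smul,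
    LinearMap.smul_apply, smul_eq_mul, neg_add_cancel]

theorem ker_mul_eq_range (he₁ : ∀ x : C, mul e x = x)
    (hNnd : ∀ x : C, (∀ y : C, N.polarBilin x y = 0) → x = 0)
    (hNmul : ∀ x y : C, N (mul x y) = N x * N y) {u : C} (hu : N.polarBilin u e = 0)
    (huN : N u = 0) {y : C} (hy : N.polarBilin u y ≠ 0) :
    LinearMap.ker (mul u) = LinearMap.range (mul u) := by
  ext z
  constructor
  · intro hz
    have h := mul_mul_eq_neg_smul he₁ hNnd hNmul hu y (z := z) hz
    have hc : N.polarBilin y u = N.polarBilin u y := QuadraticMap.polar_comm N y u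
    refine ⟨-((N.polarBilin u y)⁻¹ • mul y z), ?_⟩
    rw [map_neg, map_smul, h, hc, smul_neg, neg_neg, inv_smul_smul₀ hy]
  · rintro ⟨w, rfl⟩
    exact mul_mul_eq_zero he₁ hNnd hNmul hu huN w

/-- An isotropic vector orthogonal to `e⊥` vanishes. -/
theorem eq_zero_of_isotropic_of_orthogonal (hchar : (2 : k) ≠ 0) (hNe : N e = 1)
    (hNnd : ∀ x : C, (∀ y : C, N.polarBilin x y = 0) → x = 0) {w : C} (hwN : N w = 0)
    (hw : ∀ x : C, N.polarBilin x e = 0 → N.polarBilin w x = 0) : w = 0 := by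
  have hself : ∀ x : C, N.polarBilin x x = 2 * N x := fun x => by
    simp [QuadraticMap.polar_self]
  have hcomm : ∀ x y : C, N.polarBilin x y = N.polarBilin y x := QuadraticMap.polar_comm N
  have hee : N.polarBilin e e = 2 := by rw [hself, hNe, mul_one]
  have hproj : ∀ y : C, N.polarBilin w y = N.polarBilin y e / 2 * N.polarBilin w e := fun y => by
    have h := hw (y - (N.polarBilin y e / 2) • e) (by
      rw [map_sub, map_smul, LinearMap.sub_apply, LinearMap.smul_apply, hee, smul_eq_mul]
      field_simp
      ring)
    rw [map_sub, map_smul, smul_eq_mul] at h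
    linear_combination h
  have hwe : N.polarBilin w e = 0 := by
    have h := hproj w
    rw [hself, hwN, mul_zero] at h
    simpa [hchar] using h.symm
  exact hNnd w fun y => by rw [hproj, hwe, mul_zero]

end CompositionAlgebra

/-- The kernel of a nonzero functional, inside a subspace, has codimension one. -/
theorem finrank_inf_ker_add_one {k V : Type*} [Field k] [AddCommGroup V] [Module k V]
    [FiniteDimensional k V] (K : Submodule k V) (f : V →ₗ[k] k) {v : V} (hv : v ∈ K)
    (hfv : f v ≠ 0) : finrank k ↥(K ⊓ LinearMap.ker f) + 1 = finrank k K := by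
  have hf : f.domRestrict K ≠ 0 := fun h => hfv (LinearMap.congr_fun h ⟨v, hv⟩)
  have hmap : (LinearMap.ker (f.domRestrict K)).map K.subtype = K ⊓ LinearMap.ker f := by
    rw [LinearMap.ker_domRestrict, Submodule.map_comap_subtype]
  rw [← hmap, Submodule.finrank_map_subtype_eq]
  exact Module.Dual.finrank_ker_add_one_of_ne_zero hf

/-- In an octonion algebra `C` over an algebraically closed field of
characteristic `≠ 2`, for a nonzero isotropic imaginary vector `u`, the set
`E_u = {v ∈ V | u·v = 0}` coincides with `{v ∈ V | γ(u,v,x) = 0 for all x ∈ V}`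
(where `γ(u,v,x) = β'(u·v, x)` and `β'(x,y) = N(x+y) − N(x) − N(y)`), it is a
3-dimensional subspace, and `N` (equivalently `β'`) vanishes on it. -/
theorem octonion_eSpace
    {k : Type*} [Field k] [IsAlgClosed k] (hchar : (2 : k) ≠ 0)
    {C : Type*} [AddCommGroup C] [Module k C] [FiniteDimensional k C]
    (hdim : finrank k C = 8)
    (mul : C →ₗ[k] C →ₗ[k] C) (e : C)
    (he₁ : ∀ x : C, mul e x = x) (he₂ : ∀ x : C, mul x e = x)
    (N : QuadraticForm k C)
    (hNnd : ∀ x : C, (∀ y : C, N (x + y) - N x - N y = 0) → x = 0)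
    (hNmul : ∀ x y : C, N (mul x y) = N x * N y)
    (u : C) (hu : u ≠ 0) (huV : N (u + e) - N u - N e = 0) (huN : N u = 0) :
    ({v : C | (N (v + e) - N v - N e = 0) ∧ mul u v = 0} =
        {v : C | (N (v + e) - N v - N e = 0) ∧
          ∀ x : C, (N (x + e) - N x - N e = 0) →
            N (mul u v + x) - N (mul u v) - N x = 0}) ∧
      (∃ E : Submodule k C,
        (E : Set C) = {v : C | (N (v + e) - N v - N e = 0) ∧ mul u v = 0} ∧
          finrank k E = 3) ∧
      (∀ v : C, (N (v + e) - N v - N e = 0) ∧ mul u v = 0 → N v = 0) ∧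
      (∀ v w : C, ((N (v + e) - N v - N e = 0) ∧ mul u v = 0) →
        ((N (w + e) - N w - N e = 0) ∧ mul u w = 0) →
        N (v + w) - N v - N w = 0) := by
  have hnd : ∀ x : C, (∀ y : C, N.polarBilin x y = 0) → x = 0 := hNnd
  have hue : N.polarBilin u e = 0 := huV
  have hpolar : ∀ x y : C, N (x + y) - N x - N y = N.polarBilin x y := fun _ _ => rfl
  simp only [hpolar]
  obtain ⟨y, hy⟩ : ∃ y, N.polarBilin u y ≠ 0 := by
    by_contra! h
    exact hu (hnd u h)
  have hNe : N e = 1 := by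
    obtain ⟨x, hx⟩ : ∃ x, N x ≠ 0 := by
      by_contra! h
      exact hy (by simp [QuadraticMap.polar, h])
    have h := hNmul e x
    rw [he₁] at h
    exact (mul_eq_right₀ hx).mp h.symm
  have hker := ker_mul_eq_range he₁ hnd hNmul hue huN hy
  have hiso : ∀ v : C, mul u v = 0 → N v = 0 := fun v hv => by
    obtain ⟨w, rfl⟩ : v ∈ LinearMap.range (mul u) := hker ▸ hv
    rw [hNmul, huN, zero_mul]
  have hdimker : finrank k (LinearMap.ker (mul u)) = 4 := by
    have h := (mul u).finrank_range_add_finrank_ker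
    rw [← hker, hdim] at h
    omega
  refine ⟨?_, ⟨LinearMap.ker (mul u) ⊓ LinearMap.ker (N.polarBilin.flip e), ?_, ?_⟩,
    fun v hv => hiso v hv.2, fun v w hv hw => ?_⟩
  · ext v
    refine and_congr_right fun _ => ⟨fun h x _ => by rw [h, map_zero, LinearMap.zero_apply],
      fun h => ?_⟩
    exact eq_zero_of_isotropic_of_orthogonal hchar hNe hnd (by rw [hNmul, huN, zero_mul]) h
  · ext v
    exact and_comm
  · have hmem : mul u y ∈ LinearMap.ker (mul u) := mul_mul_eq_zero he₁ hnd hNmul hue huN y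
    have hne : N.polarBilin.flip e (mul u y) ≠ 0 := by
      rw [LinearMap.flip_apply, polar_mul_skew he₁ hNmul hue, he₂, neg_ne_zero]
      exact (QuadraticMap.polar_comm N y u).trans_ne hy
    have h := finrank_inf_ker_add_one _ _ hmem hne
    omega
  · rw [← hpolar, hiso v hv.2, hiso w hw.2, hiso (v + w) (by rw [map_add, hv.2, hw.2, add_zero]),
      sub_zero, sub_zero]
end

section
/- Let C be an octonion algebra (8-dimensional composition algebra) over an algebraically closed field k with char k ≠ 2, with identity e, norm N, and imaginary subspace V = e⊥. Let u ∈ V be a nonzero vector with N(u) = 0, and set E_u = {v ∈ V : u·v = 0}. If v, w ∈ E_u are such that {u, v, w} is a basis of E_u, then v·w = λ·u for some nonzero scalar λ ∈ k. -/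
open Module

/-!
Consequences of the composition law `N (x * y) = N x * N y`, for a unital bilinear product
`mul` on a module `C`, expressed through the polar form of `N`.
-/

namespace CompositionAlgebra

open QuadraticMap

variable {k C : Type*} [Field k] [AddCommGroup C] [Module k C]
  {mul : C →ₗ[k] C →ₗ[k] C} {e : C} {N : QuadraticForm k C}

theorem polar_mul_left (hNmul : ∀ x y : C, N (mul x y) = N x * N y) (x y z : C) :
    polar N (mul x y) (mul x z) = N x * polar N y z := by
  simp only [polar, ← map_add, hNmul]
  ring

theorem polar_mul_right (hNmul : ∀ x y : C, N (mul x y) = N x * N y) (x y z : C) :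
    polar N (mul x z) (mul y z) = polar N x y * N z := by
  simp only [polar, ← map_add, ← LinearMap.add_apply, hNmul]
  ring

theorem polar_mul_mul_add (hNmul : ∀ x y : C, N (mul x y) = N x * N y) (x y z w : C) :
    polar N (mul x y) (mul z w) + polar N (mul x w) (mul z y) = polar N x z * polar N y w := by
  have h := polar_mul_right hNmul x z (y + w)
  have hy := polar_mul_right hNmul x z y
  have hw := polar_mul_right hNmul x z w
  have hN : N (y + w) = N y + N w + polar N y w := by simp only [polar]; ring
  simp only [map_add, polar_add_left, polar_add_right, hN] at h
  linear_combination h - hy - hw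

/-- Left multiplication by an imaginary element is skew-adjoint. -/
theorem polar_mul_eq_neg_of_left (he : ∀ x : C, mul e x = x)
    (hNmul : ∀ x y : C, N (mul x y) = N x * N y) {x : C} (hx : polar N x e = 0) (y z : C) :
    polar N (mul x y) z = -polar N y (mul x z) := by
  have h := polar_mul_mul_add hNmul x y e z
  rw [he, he, hx, polar_comm N (mul x z)] at h
  linear_combination h

/-- Right multiplication by an imaginary element is skew-adjoint. -/
theorem polar_mul_eq_neg_of_right (he : ∀ x : C, mul x e = x)
    (hNmul : ∀ x y : C, N (mul x y) = N x * N y) {y : C} (hy : polar N y e = 0) (x z : C) :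
    polar N (mul x y) z = -polar N x (mul z y) := by
  have h := polar_mul_mul_add hNmul x y z e
  rw [he, he, hy] at h
  linear_combination h

theorem eq_of_polar_eq (hNnd : ∀ x : C, (∀ y : C, polar N x y = 0) → x = 0) {x y : C}
    (h : ∀ z, polar N x z = polar N y z) : x = y :=
  sub_eq_zero.1 <| hNnd _ fun z => by rw [polar_sub_left, h, sub_self]

theorem mul_mul_self_left (hNnd : ∀ x : C, (∀ y : C, polar N x y = 0) → x = 0)
    (he : ∀ x : C, mul e x = x) (hNmul : ∀ x y : C, N (mul x y) = N x * N y)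
    {x : C} (hx : polar N x e = 0) (y : C) : mul x (mul x y) = -N x • y :=
  eq_of_polar_eq hNnd fun z => by
    rw [polar_mul_eq_neg_of_left he hNmul hx, polar_mul_left hNmul, polar_smul_left, smul_eq_mul,
      neg_mul]

theorem mul_mul_self_right (hNnd : ∀ x : C, (∀ y : C, polar N x y = 0) → x = 0)
    (he : ∀ x : C, mul x e = x) (hNmul : ∀ x y : C, N (mul x y) = N x * N y)
    {x : C} (hx : polar N x e = 0) (y : C) : mul (mul y x) x = -N x • y :=
  eq_of_polar_eq hNnd fun z => by
    rw [polar_mul_eq_neg_of_right he hNmul hx, polar_mul_right hNmul, polar_smul_left,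
      smul_eq_mul]
    ring

theorem mul_mul_add_mul_mul (hNnd : ∀ x : C, (∀ y : C, polar N x y = 0) → x = 0)
    (he : ∀ x : C, mul e x = x) (hNmul : ∀ x y : C, N (mul x y) = N x * N y)
    {x y : C} (hx : polar N x e = 0) (hy : polar N y e = 0) (z : C) :
    mul x (mul y z) + mul y (mul x z) = -polar N x y • z :=
  eq_of_polar_eq hNnd fun t => by
    have h := polar_mul_mul_add hNmul x z y t
    rw [polar_add_left, polar_smul_left, polar_mul_eq_neg_of_left he hNmul hx (mul y z),
      polar_mul_eq_neg_of_left he hNmul hy (mul x z), smul_eq_mul, polar_comm N (mul y z)]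
    linear_combination -h

/-- If `x * y = 0` with `y` imaginary, then `(x * g) * y` is a multiple of `x`. -/
theorem mul_mul_of_mul_eq_zero (hNnd : ∀ x : C, (∀ y : C, polar N x y = 0) → x = 0)
    (he : ∀ x : C, mul x e = x) (hNmul : ∀ x y : C, N (mul x y) = N x * N y)
    {x y : C} (hy : polar N y e = 0) (hxy : mul x y = 0) (g : C) :
    mul (mul x g) y = -polar N g y • x :=
  eq_of_polar_eq hNnd fun z => by
    have h := polar_mul_mul_add hNmul x g z y
    rw [hxy, polar_zero_left] at h
    rw [polar_mul_eq_neg_of_right he hNmul hy, polar_smul_left, smul_eq_mul]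
    linear_combination -h

theorem polar_eq_zero_of_mul_eq_zero (he₁ : ∀ x : C, mul e x = x)
    (he₂ : ∀ x : C, mul x e = x) (hNmul : ∀ x y : C, N (mul x y) = N x * N y)
    {x y : C} (hx : polar N x e = 0) (hxy : mul x y = 0) : polar N y x = 0 := by
  have h := polar_mul_eq_neg_of_left he₁ hNmul hx y e
  rw [hxy, polar_zero_left, he₂] at h
  exact neg_eq_zero.1 h.symm

theorem norm_eq_zero_of_mul_eq_zero (hNnd : ∀ x : C, (∀ y : C, polar N x y = 0) → x = 0)
    (he : ∀ x : C, mul x e = x) (hNmul : ∀ x y : C, N (mul x y) = N x * N y)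
    {x y : C} (hx : x ≠ 0) (hy : polar N y e = 0) (hxy : mul x y = 0) : N y = 0 := by
  have h := mul_mul_self_right hNnd he hNmul hy x
  rw [hxy, map_zero, LinearMap.zero_apply] at h
  simpa [hx] using h.symm

/-- Linearly independent vectors are separated by the orthogonal complement of either. -/
theorem exists_polar_eq_zero_polar_ne_zero
    (hNnd : ∀ x : C, (∀ y : C, polar N x y = 0) → x = 0) {x y : C} (hx : x ≠ 0)
    (hxy : ∀ c : k, y ≠ c • x) : ∃ g, polar N g x = 0 ∧ polar N g y ≠ 0 := by
  by_contra! hg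
  obtain ⟨t, ht⟩ : ∃ t, polar N t x ≠ 0 := by
    by_contra! h
    exact hx (hNnd x fun t => polar_comm N x t ▸ h t)
  refine hxy (polar N t y / polar N t x) (eq_of_polar_eq hNnd fun z => ?_)
  have h := hg (z - (polar N z x / polar N t x) • t) (by
    rw [polar_sub_left, polar_smul_left, smul_eq_mul]
    field_simp
    ring)
  rw [polar_sub_left, polar_smul_left, smul_eq_mul] at h
  rw [polar_smul_left, smul_eq_mul, polar_comm N y, polar_comm N x]
  linear_combination h

end CompositionAlgebra

open CompositionAlgebra QuadraticMap

/-- In an octonion algebra over an algebraically closed field of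
characteristic `≠ 2`, if `u` is a nonzero isotropic imaginary vector and `{u, v, w}` is
a basis of `E_u = {z ∈ V | u·z = 0}`, then `v·w = λ·u` for some nonzero scalar `λ`. -/
theorem octonion_product_in_eSpace
    {k : Type*} [Field k] [IsAlgClosed k] (hchar : (2 : k) ≠ 0)
    {C : Type*} [AddCommGroup C] [Module k C] [FiniteDimensional k C]
    (hdim : finrank k C = 8)
    (mul : C →ₗ[k] C →ₗ[k] C) (e : C)
    (he₁ : ∀ x : C, mul e x = x) (he₂ : ∀ x : C, mul x e = x)
    (N : QuadraticForm k C)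
    (hNnd : ∀ x : C, (∀ y : C, N (x + y) - N x - N y = 0) → x = 0)
    (hNmul : ∀ x y : C, N (mul x y) = N x * N y)
    (u : C) (hu : u ≠ 0) (huV : N (u + e) - N u - N e = 0) (huN : N u = 0)
    (v w : C)
    (hvE : (N (v + e) - N v - N e = 0) ∧ mul u v = 0)
    (hwE : (N (w + e) - N w - N e = 0) ∧ mul u w = 0)
    (hindep : LinearIndependent k ![u, v, w])
    (hspan : (Submodule.span k {u, v, w} : Set C) =
      {z : C | (N (z + e) - N z - N e = 0) ∧ mul u z = 0}) :
    ∃ lam : k, lam ≠ 0 ∧ mul v w = lam • u := by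
  change polar N u e = 0 at huV
  obtain ⟨hvV, huv⟩ : polar N v e = 0 ∧ mul u v = 0 := hvE
  obtain ⟨hwV, huw⟩ : polar N w e = 0 ∧ mul u w = 0 := hwE
  have mem_span (z : C) (hz : polar N z e = 0) (huz : mul u z = 0) :
      ∃ a b c : k, z = a • u + b • v + c • w := by
    have hmem : z ∈ (Submodule.span k {u, v, w} : Set C) := by
      rw [hspan]
      exact ⟨hz, huz⟩
    obtain ⟨a, b, c, h⟩ := Submodule.mem_span_triple.1 hmem
    exact ⟨a, b, c, h.symm⟩
  have norm_zero {z : C} (hz : polar N z e = 0) (huz : mul u z = 0) : N z = 0 :=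
    norm_eq_zero_of_mul_eq_zero hNnd he₂ hNmul hu hz huz
  have hNv := norm_zero hvV huv
  have hNw := norm_zero hwV huw
  have hvw : polar N v w = 0 := by
    have h := norm_zero (z := v + w) (by rw [polar_add_left, hvV, hwV, add_zero])
      (by rw [map_add, huv, huw, add_zero])
    simp only [polar, h, hNv, hNw, sub_zero]
  have anticomm {x y : C} (hx : polar N x e = 0) (hy : polar N y e = 0)
      (hxy : polar N x y = 0) : mul x y = -mul y x := by
    have h := mul_mul_add_mul_mul hNnd he₁ hNmul hx hy e
    rw [he₂, he₂, hxy, neg_zero, zero_smul] at h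
    exact eq_neg_of_add_eq_zero_left h
  have huv' : polar N u v = 0 := by
    rw [polar_comm, polar_eq_zero_of_mul_eq_zero he₁ he₂ hNmul huV huv]
  have hvu : mul v u = 0 := by
    rw [anticomm hvV huV (by rw [polar_comm, huv']), huv, neg_zero]
  have hvv : mul v v = 0 := by
    simpa [he₂, hNv] using mul_mul_self_left hNnd he₁ hNmul hvV e
  have hvw_ne : mul v w ≠ 0 := by
    intro h0
    have hwv : mul w v = 0 := by
      rw [anticomm hwV hvV (by rw [polar_comm, hvw]), h0, neg_zero]
    obtain ⟨g, hgu, hgv⟩ := exists_polar_eq_zero_polar_ne_zero hNnd hu (y := v) fun c hc => by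
      have h := Fintype.linearIndependent_iff.1 hindep ![c, -1, 0]
        (by simp [Fin.sum_univ_three, hc]) 1
      simp at h
    obtain ⟨a, b, c, habc⟩ := mem_span (mul u g)
      (by rw [polar_mul_eq_neg_of_left he₁ hNmul huV, he₂, hgu, neg_zero])
      (by rw [mul_mul_self_left hNnd he₁ hNmul huV, huN, neg_zero, zero_smul])
    have h := mul_mul_of_mul_eq_zero hNnd he₂ hNmul hvV huv g
    rw [habc] at h
    simp only [map_add, map_smul, LinearMap.add_apply, LinearMap.smul_apply, huv, hvv, hwv,
      smul_zero, add_zero] at h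
    simp [hgv, hu] at h
  obtain ⟨a, b, c, habc⟩ := mem_span (mul v w)
    (by rw [polar_mul_eq_neg_of_left he₁ hNmul hvV, he₂, polar_comm, hvw, neg_zero])
    (by
      have h := mul_mul_add_mul_mul hNnd he₁ hNmul huV hvV w
      rwa [huw, map_zero, add_zero, huv', neg_zero, zero_smul] at h)
  have hww : mul w w = 0 := by
    simpa [he₂, hNw] using mul_mul_self_left hNnd he₁ hNmul hwV e
  have hc : c = 0 := by
    have h := mul_mul_self_left hNnd he₁ hNmul hvV w
    rw [habc] at h
    simpa [hvu, hvv, hNv, hvw_ne] using h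
  have hb : b = 0 := by
    have h := mul_mul_self_right hNnd he₂ hNmul hwV v
    rw [habc] at h
    simpa [huw, hww, hNw, hvw_ne] using h
  have hvw_eq : mul v w = a • u := by rw [habc, hb, hc, zero_smul, zero_smul, add_zero, add_zero]
  refine ⟨a, ?_, hvw_eq⟩
  rintro rfl
  exact hvw_ne (by rw [hvw_eq, zero_smul])
end

section
/- Let k be an algebraically closed field with char k ≠ 2, V a 7-dimensional k-vector space, and γ a nondegenerate alternating trilinear form on V. If β₁ and β₂ are two nondegenerate symmetric bilinear forms on V each compatible with γ, then there exists ω ∈ k with ω³ = 1 such that β₂ = ω·β₁. -/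
open Module

section CompatibleForms

variable {k V : Type*} [Field k] [AddCommGroup V] [Module k V]

/-- Monic quadratic polynomials over an algebraically closed field (of characteristic not two)
with the same roots have the same coefficients. -/
theorem quadratic_coeffs_eq_of_roots_iff [IsAlgClosed k] (h2 : (2 : k) ≠ 0) {b₁ c₁ b₂ c₂ : k}
    (h : ∀ t : k, t ^ 2 + 2 * b₁ * t + c₁ = 0 ↔ t ^ 2 + 2 * b₂ * t + c₂ = 0) :
    b₁ = b₂ ∧ c₁ = c₂ := by
  obtain ⟨s, hs⟩ := IsAlgClosed.exists_pow_nat_eq (b₁ ^ 2 - c₁) (n := 2) two_pos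
  obtain ⟨r, hr⟩ := IsAlgClosed.exists_pow_nat_eq (b₂ ^ 2 - c₂) (n := 2) two_pos
  have h₁ := (h (-b₁ + s)).1 (by linear_combination hs)
  have h₂ := (h (-b₁ - s)).1 (by linear_combination hs)
  have h₃ := (h (-b₂ + r)).2 (by linear_combination hr)
  have h₄ := (h (-b₂ - r)).2 (by linear_combination hr)
  have hb : b₁ = b₂ := by
    by_cases hs0 : s = 0
    · by_cases hr0 : r = 0
      · subst hs0 hr0
        have : (b₂ - b₁) ^ 2 = 0 := by linear_combination h₁ - hr
        exact (sub_eq_zero.1 (pow_eq_zero_iff two_ne_zero |>.1 this)).symm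
      · have : (2 * 2 * r) * (b₁ - b₂) = 0 := by linear_combination h₃ - h₄
        exact sub_eq_zero.1 ((mul_eq_zero.1 this).resolve_left (by simp [h2, hr0]))
    · have : (2 * 2 * s) * (b₂ - b₁) = 0 := by linear_combination h₁ - h₂
      exact (sub_eq_zero.1 ((mul_eq_zero.1 this).resolve_left (by simp [h2, hs0]))).symm
  subst hb
  exact ⟨rfl, by linear_combination hs - h₁⟩

/-- A symmetric bilinear form is determined by its quadratic form. -/
theorem bilin_eq_smul_of_forall_self (h2 : (2 : k) ≠ 0) {β₁ β₂ : V →ₗ[k] V →ₗ[k] k}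
    (hs₁ : ∀ u v, β₁ u v = β₁ v u) (hs₂ : ∀ u v, β₂ u v = β₂ v u) {c : k}
    (h : ∀ u, β₂ u u = c * β₁ u u) (u v : V) : β₂ u v = c * β₁ u v := by
  have huv := h (u + v)
  simp only [map_add, LinearMap.add_apply] at huv
  apply mul_left_cancel₀ h2
  linear_combination huv - h u - h v + hs₂ u v - c * hs₁ u v

/-- Symmetric bilinear forms with the same isotropic vectors are proportional, over an
algebraically closed field of characteristic not two. -/
theorem exists_bilin_eq_mul_of_isotropic_iff [IsAlgClosed k] (h2 : (2 : k) ≠ 0)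
    {β₁ β₂ : V →ₗ[k] V →ₗ[k] k}
    (hs₁ : ∀ u v, β₁ u v = β₁ v u) (hs₂ : ∀ u v, β₂ u v = β₂ v u)
    (h : ∀ u, β₁ u u = 0 ↔ β₂ u u = 0) : ∃ c : k, ∀ u v, β₂ u v = c * β₁ u v := by
  by_cases h0 : ∀ u, β₁ u u = 0
  · exact ⟨0, bilin_eq_smul_of_forall_self h2 hs₁ hs₂ fun u => by simp [(h u).1 (h0 u)]⟩
  push Not at h0
  obtain ⟨u, hu₁⟩ := h0
  have hu₂ : β₂ u u ≠ 0 := fun H => hu₁ ((h u).2 H)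
  refine ⟨β₂ u u / β₁ u u, bilin_eq_smul_of_forall_self h2 hs₁ hs₂ fun v => ?_⟩
  have expand (β : V →ₗ[k] V →ₗ[k] k) (hs : ∀ u v, β u v = β v u) (hu : β u u ≠ 0) (t : k) :
      β (v + t • u) (v + t • u) = 0 ↔
        t ^ 2 + 2 * (β u v / β u u) * t + β v v / β u u = 0 := by
    have : β (v + t • u) (v + t • u) =
        β u u * (t ^ 2 + 2 * (β u v / β u u) * t + β v v / β u u) := by
      simp only [map_add, LinearMap.add_apply, map_smul, LinearMap.smul_apply, smul_eq_mul, hs v u]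
      field_simp
      ring
    rw [this, mul_eq_zero, or_iff_right hu]
  have hc := (quadratic_coeffs_eq_of_roots_iff h2 fun t =>
    (expand β₁ hs₁ hu₁ t).symm.trans ((h _).trans (expand β₂ hs₂ hu₂ t))).2
  field_simp at hc ⊢
  linear_combination -hc

namespace AlternatingMap

theorem map_swap_last_two (γ : V [⋀^Fin 3]→ₗ[k] k) (u v w : V) :
    γ ![u, w, v] = -γ ![u, v, w] := by
  rw [← γ.map_swap ![u, v, w] (i := 1) (j := 2) (by decide)]
  congr 1
  ext i
  fin_cases i <;> rfl

/-- Fixing the first argument of an alternating trilinear form gives a bilinear form. -/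
def contractLeft (γ : V [⋀^Fin 3]→ₗ[k] k) (u : V) : V →ₗ[k] V →ₗ[k] k :=
  LinearMap.mk₂ k (fun v x => γ ![u, v, x])
    (fun a b x => (γ.curryLeft u).map_vecCons_add ![x] a b)
    (fun c a x => (γ.curryLeft u).map_vecCons_smul ![x] c a)
    (fun v a b => ((γ.curryLeft u).curryLeft v).map_vecCons_add ![] a b)
    (fun c v a => ((γ.curryLeft u).curryLeft v).map_vecCons_smul ![] c a)

@[simp]
theorem contractLeft_apply (γ : V [⋀^Fin 3]→ₗ[k] k) (u v x : V) :
    γ.contractLeft u v x = γ ![u, v, x] := rfl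

end AlternatingMap

/-- Compatibility of an alternating trilinear form with a symmetric bilinear form. -/
def IsCompatible (γ : V [⋀^Fin 3]→ₗ[k] k) (β : V →ₗ[k] V →ₗ[k] k) : Prop :=
  ∀ u v : V, ∃ d : V, (∀ x : V, β d x = γ ![u, v, x]) ∧
    2 * γ ![u, v, d] = β u u * β v v - (β u v) ^ 2

namespace IsCompatible

variable {γ : V [⋀^Fin 3]→ₗ[k] k} {β : V →ₗ[k] V →ₗ[k] k}

/-- Left multiplication by a fixed vector in the cross product attached to `γ` and `β`. -/
theorem exists_crossLeft [FiniteDimensional k V] (hc : IsCompatible γ β)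
    (hnd : ∀ u, (∀ v, β u v = 0) → u = 0) (u : V) :
    ∃ L : V →ₗ[k] V, (∀ v x, β (L v) x = γ ![u, v, x]) ∧
      ∀ v, 2 * γ ![u, v, L v] = β u u * β v v - (β u v) ^ 2 := by
  have hinj : Function.Injective β :=
    (injective_iff_map_eq_zero β).2 fun a ha => hnd a fun v => by simp [ha]
  let e := β.linearEquivOfInjective hinj Subspace.dual_finrank_eq.symm
  have he (v x : V) : β (e.symm (γ.contractLeft u v)) x = γ ![u, v, x] :=
    LinearMap.congr_fun (e.apply_symm_apply (γ.contractLeft u v)) x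
  refine ⟨e.symm.toLinearMap ∘ₗ γ.contractLeft u, he, fun v => ?_⟩
  obtain ⟨d, hd, hd'⟩ := hc u v
  have : e.symm (γ.contractLeft u v) = d := hinj (LinearMap.ext fun x => by rw [he, hd])
  rw [← hd', ← this]
  rfl

/-- The double cross product formula `2 u × (u × w) = β(u, w) u - β(u, u) w`, tested
against `v`. -/
theorem exists_crossLeft_sq [FiniteDimensional k V] (hc : IsCompatible γ β) (h2 : (2 : k) ≠ 0)
    (hs : ∀ u v, β u v = β v u) (hnd : ∀ u, (∀ v, β u v = 0) → u = 0) (u : V) :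
    ∃ L : V →ₗ[k] V, (∀ v x, β (L v) x = γ ![u, v, x]) ∧
      ∀ w v, 2 * β (L (L w)) v = β u w * β u v - β u u * β w v := by
  obtain ⟨L, hL, hq⟩ := hc.exists_crossLeft hnd u
  refine ⟨L, hL, fun w v => mul_left_cancel₀ h2 ?_⟩
  have hadd := hq (v + w)
  simp only [← hL, map_add, LinearMap.add_apply] at hadd hq
  have hswap : β (L (L w)) v = -β (L v) (L w) := by rw [hL, hL, γ.map_swap_last_two]
  linear_combination -hadd + hq v + hq w + 2 * 2 * hswap - 2 * hs (L v) (L w) + β u u * hs w v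

/-- Non-isotropic vectors `u` have the kernel of `γ(u, ·, ·)` as small as possible. -/
theorem mem_span_of_forall_eq_zero [FiniteDimensional k V] (hc : IsCompatible γ β)
    (h2 : (2 : k) ≠ 0) (hs : ∀ u v, β u v = β v u) (hnd : ∀ u, (∀ v, β u v = 0) → u = 0)
    {u v : V} (hu : β u u ≠ 0) (hv : ∀ x, γ ![u, v, x] = 0) : v ∈ Submodule.span k {u} := by
  obtain ⟨L, hL, hq⟩ := hc.exists_crossLeft_sq h2 hs hnd u
  have hLv : L v = 0 := hnd _ fun x => by rw [hL, hv]
  have key : v - (β u v / β u u) • u = 0 := hnd _ fun x => by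
    have := hq v x
    simp only [hLv, map_zero, LinearMap.zero_apply] at this
    simp only [map_sub, map_smul, LinearMap.sub_apply, LinearMap.smul_apply, smul_eq_mul]
    field_simp
    linear_combination this
  rw [sub_eq_zero.1 key]
  exact Submodule.smul_mem _ _ (Submodule.mem_span_singleton_self u)

/-- If `u` is isotropic, then the kernel of `γ(u, ·, ·)` is not contained in a line. -/
theorem exists_notMem_span_of_isotropic [FiniteDimensional k V] (hc : IsCompatible γ β)
    (h2 : (2 : k) ≠ 0) (hs : ∀ u v, β u v = β v u) (hnd : ∀ u, (∀ v, β u v = 0) → u = 0)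
    (hdim : 4 ≤ finrank k V) {u : V} (hu : β u u = 0) :
    ∃ v, v ∉ Submodule.span k {u} ∧ ∀ x, γ ![u, v, x] = 0 := by
  obtain ⟨L, hL, hq⟩ := hc.exists_crossLeft_sq h2 hs hnd u
  by_contra! hcon
  have hspan (v : V) (hv : L v = 0) : v ∈ Submodule.span k {u} := by
    by_contra hvu
    obtain ⟨x, hx⟩ := hcon v hvu
    exact hx (by simp [← hL, hv])
  have hline : finrank k (Submodule.span k {u}) ≤ 1 := by
    simpa using finrank_span_le_card (R := k) ({u} : Set V)
  let W := LinearMap.ker (β u)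
  have hrange : finrank k (LinearMap.range (L.domRestrict W)) ≤ 1 := by
    refine (Submodule.finrank_mono ?_).trans hline
    rintro _ ⟨w, rfl⟩
    refine hspan _ (hnd _ fun x => mul_left_cancel₀ h2 ?_)
    rw [LinearMap.domRestrict_apply, hq, hu, LinearMap.mem_ker.1 w.2]
    ring
  have hker : finrank k (LinearMap.ker (L.domRestrict W)) ≤ 1 := by
    rw [← Submodule.finrank_map_subtype_eq]
    refine (Submodule.finrank_mono ?_).trans hline
    rintro _ ⟨w, hw, rfl⟩
    exact hspan _ hw
  have hW := (β u).finrank_range_add_finrank_ker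
  have hu1 : finrank k (LinearMap.range (β u)) ≤ 1 :=
    (Submodule.finrank_le _).trans (finrank_self k).le
  have := (L.domRestrict W).finrank_range_add_finrank_ker
  have : finrank k W = finrank k (LinearMap.ker (β u)) := rfl
  omega

/-- The isotropic vectors of a compatible form are determined by `γ`. -/
theorem isotropic_iff [FiniteDimensional k V] (hc : IsCompatible γ β) (h2 : (2 : k) ≠ 0)
    (hs : ∀ u v, β u v = β v u) (hnd : ∀ u, (∀ v, β u v = 0) → u = 0)
    (hdim : 4 ≤ finrank k V) (u : V) :
    β u u = 0 ↔ ∃ v, v ∉ Submodule.span k {u} ∧ ∀ x, γ ![u, v, x] = 0 :=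
  ⟨hc.exists_notMem_span_of_isotropic h2 hs hnd hdim, fun ⟨_, hvu, hv⟩ => by
    by_contra hu
    exact hvu (hc.mem_span_of_forall_eq_zero h2 hs hnd hu hv)⟩

end IsCompatible

/-- A nondegenerate symmetric form on a space of dimension at least two is nondegenerate
on some plane. -/
theorem exists_gram_ne_zero (h2 : (2 : k) ≠ 0) {β : V →ₗ[k] V →ₗ[k] k}
    (hs : ∀ u v, β u v = β v u) (hnd : ∀ u, (∀ v, β u v = 0) → u = 0) (hdim : 1 < finrank k V) :
    ∃ u v, β u u * β v v - (β u v) ^ 2 ≠ 0 := by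
  by_contra! h
  have hpolar (u v w : V) : β u u * β v w = β u v * β u w := by
    have hvw := h u (v + w)
    simp only [map_add, LinearMap.add_apply] at hvw
    apply mul_left_cancel₀ h2
    linear_combination hvw - h u v - h u w + β u u * hs v w
  have hne : ∃ u, β u u ≠ 0 := by
    by_contra! hz
    have hzero := bilin_eq_smul_of_forall_self h2 hs hs (c := 0) fun u => by simp [hz u]
    have : Subsingleton V := subsingleton_of_forall_eq 0 fun u =>
      hnd u fun v => by simpa using hzero u v
    simp [finrank_zero_of_subsingleton] at hdim
  obtain ⟨u, hu⟩ := hne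
  refine hdim.not_ge (finrank_le_one u fun v => ⟨β u v / β u u, ?_⟩)
  refine (sub_eq_zero.1 (hnd _ fun w => ?_)).symm
  simp only [map_sub, map_smul, LinearMap.sub_apply, LinearMap.smul_apply, smul_eq_mul]
  field_simp
  linear_combination hpolar u v w

/-- The scaling factor between two compatible forms is a cube root of unity. -/
theorem IsCompatible.pow_three_eq_one {γ : V [⋀^Fin 3]→ₗ[k] k} {β₁ β₂ : V →ₗ[k] V →ₗ[k] k}
    (hc₁ : IsCompatible γ β₁) (hc₂ : IsCompatible γ β₂) (h2 : (2 : k) ≠ 0)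
    (hs : ∀ u v, β₁ u v = β₁ v u) (hnd : ∀ u, (∀ v, β₁ u v = 0) → u = 0)
    (hdim : 1 < finrank k V) {c : k} (h : ∀ u v, β₂ u v = c * β₁ u v) : c ^ 3 = 1 := by
  obtain ⟨u, v, huv⟩ := exists_gram_ne_zero h2 hs hnd hdim
  obtain ⟨d₁, hd₁, hq₁⟩ := hc₁ u v
  obtain ⟨d₂, hd₂, hq₂⟩ := hc₂ u v
  have hd : γ ![u, v, d₁] = c * γ ![u, v, d₂] := by
    rw [← hd₂ d₁, ← hd₁ d₂, h, hs d₁ d₂]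
  apply mul_right_cancel₀ huv
  simp only [h] at hq₂
  linear_combination hq₁ - c * hq₂ - 2 * hd

end CompatibleForms

/-- Any two nondegenerate symmetric bilinear forms compatible with a fixed
nondegenerate alternating trilinear form `γ` on a 7-dimensional space differ by a cube
root of unity. -/
theorem compatible_forms_unique_up_to_cube_root
    {k : Type*} [Field k] [IsAlgClosed k] (hchar : (2 : k) ≠ 0)
    {V : Type*} [AddCommGroup V] [Module k V] [FiniteDimensional k V]
    (hdim : finrank k V = 7)
    (γ : V [⋀^Fin 3]→ₗ[k] k)
    (β₁ β₂ : V →ₗ[k] V →ₗ[k] k)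
    (hβ₁symm : ∀ u v : V, β₁ u v = β₁ v u)
    (hβ₁nd : ∀ u : V, (∀ v : V, β₁ u v = 0) → u = 0)
    (hβ₂symm : ∀ u v : V, β₂ u v = β₂ v u)
    (hβ₂nd : ∀ u : V, (∀ v : V, β₂ u v = 0) → u = 0)
    (hcompat₁ : ∀ u v : V, ∃ d : V, (∀ x : V, β₁ d x = γ ![u, v, x]) ∧
      2 * γ ![u, v, d] = β₁ u u * β₁ v v - (β₁ u v) ^ 2)
    (hcompat₂ : ∀ u v : V, ∃ d : V, (∀ x : V, β₂ d x = γ ![u, v, x]) ∧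
      2 * γ ![u, v, d] = β₂ u u * β₂ v v - (β₂ u v) ^ 2) :
    ∃ ω : k, ω ^ 3 = 1 ∧ ∀ u v : V, β₂ u v = ω * β₁ u v := by
  have hc₁ : IsCompatible γ β₁ := hcompat₁
  have hc₂ : IsCompatible γ β₂ := hcompat₂
  have hdim4 : 4 ≤ finrank k V := by omega
  obtain ⟨c, hc⟩ := exists_bilin_eq_mul_of_isotropic_iff hchar hβ₁symm hβ₂symm fun u =>
    (hc₁.isotropic_iff hchar hβ₁symm hβ₁nd hdim4 u).trans
      (hc₂.isotropic_iff hchar hβ₂symm hβ₂nd hdim4 u).symm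
  exact ⟨c, hc₁.pow_three_eq_one hc₂ hchar hβ₁symm hβ₁nd (by omega) hc, hc⟩
end

section
/- Let W be the dihedral group of order 12 (the Weyl group of type G₂), with its two Coxeter generators s and t and length function ℓ (so ℓ(s) = ℓ(t) = 1 and the longest element has length 6). Suppose (P_w)_{w ∈ W} is a family of nonzero homogeneous polynomials in ℚ[x₁, x₂] with deg P_w = ℓ(w) for every w, satisfying for every w ∈ W: (i) if ℓ(ws) < ℓ(w) then P_w(x₁, x₂) − P_w(x₂, x₁) = (x₁ − x₂)·P_{ws}(x₁, x₂), and if ℓ(ws) > ℓ(w) then P_w(x₁, x₂) = P_w(x₂, x₁); (ii) if ℓ(wt) < ℓ(w) then P_w(x₁, x₂) − P_w(x₁, x₁ − x₂) = (−x₁ + 2x₂)·P_{wt}(x₁, x₂), and if ℓ(wt) > ℓ(w) then P_w(x₁, x₂) = P_w(x₁, x₁ − x₂). Then there exists w ∈ W such that P_w has both a (strictly) positive coefficient and a (strictly) negative coefficient. -/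
open MvPolynomial

theorem eval_aeval_swap (a b : ℚ) (p : MvPolynomial (Fin 2) ℚ) :
    eval ![a, b] ((aeval ![(X 1 : MvPolynomial (Fin 2) ℚ), X 0]) p) = eval ![b, a] p := by
  induction p using MvPolynomial.induction_on with
  | C c => simp
  | add p q hp hq => simp only [map_add, hp, hq]
  | mul_X p i hp =>
    rw [map_mul, map_mul, map_mul, hp]
    fin_cases i <;> simp

theorem eval_aeval_reflection (a b : ℚ) (p : MvPolynomial (Fin 2) ℚ) :
    eval ![a, b] ((aeval ![(X 0 : MvPolynomial (Fin 2) ℚ), X 0 - X 1]) p) =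
      eval ![a, a - b] p := by
  induction p using MvPolynomial.induction_on with
  | C c => simp
  | add p q hp hq => simp only [map_add, hp, hq]
  | mul_X p i hp =>
    rw [map_mul, map_mul, map_mul, hp]
    fin_cases i <;> simp

/-- A homogeneous polynomial in two variables which is invariant under `x₂ ↦ x₁ - x₂` and whose
coefficients do not take both signs is a multiple of a power of `x₁`. -/
theorem exists_eval_eq_mul_pow {n : ℕ} {p : MvPolynomial (Fin 2) ℚ} (hp : p.IsHomogeneous n)
    (hinv : (aeval ![(X 0 : MvPolynomial (Fin 2) ℚ), X 0 - X 1]) p = p)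
    (hsign : (∀ m, 0 ≤ p.coeff m) ∨ ∀ m, p.coeff m ≤ 0) :
    ∃ α : ℚ, ∀ a b : ℚ, eval ![a, b] p = α * a ^ n := by
  have heval : ∀ a b : ℚ, eval ![a, b] p =
      ∑ m ∈ p.support, p.coeff m * (a ^ m 0 * b ^ m 1) := fun a b ↦ by
    rw [eval_eq']
    simp [Fin.prod_univ_two]
  have hsum : ∑ m ∈ p.support, p.coeff m * (1 - 0 ^ m 1) = 0 := by
    have h := eval_aeval_reflection 1 1 p
    rw [hinv, sub_self, heval, heval] at h
    simpa [mul_sub, Finset.sum_sub_distrib, sub_eq_zero] using h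
  have hfactor : ∀ k : ℕ, (0 : ℚ) ≤ 1 - 0 ^ k := fun k ↦ by
    rcases k with _ | k <;> simp
  have hzero : ∀ m ∈ p.support, p.coeff m * (1 - 0 ^ m 1) = 0 := by
    rcases hsign with hsign | hsign
    · exact (Finset.sum_eq_zero_iff_of_nonneg
        fun m _ ↦ mul_nonneg (hsign m) (hfactor _)).mp hsum
    · exact (Finset.sum_eq_zero_iff_of_nonpos
        fun m _ ↦ mul_nonpos_of_nonpos_of_nonneg (hsign m) (hfactor _)).mp hsum
  refine ⟨∑ m ∈ p.support, p.coeff m, fun a b ↦ ?_⟩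
  rw [heval, Finset.sum_mul]
  refine Finset.sum_congr rfl fun m hm ↦ ?_
  have hcoeff : p.coeff m ≠ 0 := mem_support_iff.mp hm
  have hm1 : m 1 = 0 := by
    by_contra h
    simpa [h, hcoeff] using hzero m hm
  have hm0 : m 0 = n := by
    have h := hp hcoeff
    rw [Finsupp.weight_apply, Finsupp.sum_fintype _ _ (by simp)] at h
    simpa [Fin.sum_univ_two, hm1] using h
  simp [hm0, hm1]

/-- The images of the simple generators of the Weyl group of type `G₂` in `DihedralGroup 6`. -/
def dihedralGenerator : Fin 2 → DihedralGroup 6 := ![.sr 0, .sr 1]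

theorem isLiftable_dihedralGenerator : CoxeterMatrix.G₂.IsLiftable dihedralGenerator := by
  unfold CoxeterMatrix.IsLiftable
  decide

theorem lift_wordProd {W : Type*} [Group W] (cs : CoxeterSystem CoxeterMatrix.G₂ W)
    (ω : List (Fin 2)) :
    cs.lift ⟨dihedralGenerator, isLiftable_dihedralGenerator⟩ (cs.wordProd ω) =
      (ω.map dihedralGenerator).prod := by
  induction ω with
  | nil => simp
  | cons i ω ih => simp [cs.wordProd_cons, ih]

/-- The alternating word of length five is reduced in type `G₂`. -/
theorem length_wordProd_alternating {W : Type*} [Group W]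
    (cs : CoxeterSystem CoxeterMatrix.G₂ W) :
    cs.length (cs.wordProd [1, 0, 1, 0, 1]) = 5 := by
  have hle := cs.length_wordProd_le [1, 0, 1, 0, 1]
  obtain ⟨ω, hred, hω⟩ := cs.exists_isReduced (cs.wordProd [1, 0, 1, 0, 1])
  have h := congrArg (cs.lift ⟨dihedralGenerator, isLiftable_dihedralGenerator⟩) hω
  rw [lift_wordProd, lift_wordProd] at h
  by_contra hne
  have hlt : ω.length < 5 := by
    rw [← hred.eq, ← hω]
    exact lt_of_le_of_ne hle hne
  clear hω hred
  match ω, hlt with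
  | [], _ => revert h; decide
  | [a], hlt => clear hlt; revert a; decide
  | [a, b], hlt => clear hlt; revert a b; decide
  | [a, b, c], hlt => clear hlt; revert a b c; decide
  | [a, b, c, d], hlt => clear hlt; revert a b c d; decide

/-- For the Weyl group `W` of type `G₂` (the dihedral group of order 12,
presented as a Coxeter system with generators `s = simple 0`, `t = simple 1`), any family
of nonzero homogeneous polynomials `P_w ∈ ℚ[x₁,x₂]` with `deg P_w = ℓ(w)` that is
compatible with the `G₂` divided difference operators `∂_s`, `∂_t` must contain a
polynomial with both a positive and a negative coefficient. -/
theorem no_positive_G2_schubert_polynomials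
    {W : Type*} [Group W] (cs : CoxeterSystem CoxeterMatrix.G₂ W)
    (P : W → MvPolynomial (Fin 2) ℚ)
    (hne : ∀ w : W, P w ≠ 0)
    (hhom : ∀ w : W, (P w).IsHomogeneous (cs.length w))
    (hs : ∀ w : W,
      (cs.length (w * cs.simple 0) < cs.length w →
        P w - (aeval ![(X 1 : MvPolynomial (Fin 2) ℚ), X 0]) (P w) =
          (X 0 - X 1) * P (w * cs.simple 0)) ∧
      (cs.length w < cs.length (w * cs.simple 0) →
        (aeval ![(X 1 : MvPolynomial (Fin 2) ℚ), X 0]) (P w) = P w))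
    (ht : ∀ w : W,
      (cs.length (w * cs.simple 1) < cs.length w →
        P w - (aeval ![(X 0 : MvPolynomial (Fin 2) ℚ), X 0 - X 1]) (P w) =
          (-X 0 + 2 * X 1) * P (w * cs.simple 1)) ∧
      (cs.length w < cs.length (w * cs.simple 1) →
        (aeval ![(X 0 : MvPolynomial (Fin 2) ℚ), X 0 - X 1]) (P w) = P w)) :
    ∃ w : W, (∃ m : Fin 2 →₀ ℕ, 0 < (P w).coeff m) ∧
      (∃ m : Fin 2 →₀ ℕ, (P w).coeff m < 0) := by
  by_contra! hmixed
  have hsign : ∀ w, (∀ m, 0 ≤ (P w).coeff m) ∨ ∀ m, (P w).coeff m ≤ 0 := fun w ↦ by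
    by_cases h : ∃ m, 0 < (P w).coeff m
    · exact .inl (hmixed w h)
    · exact .inr (by simpa using h)
  set u := cs.simple 1 * cs.simple 0 with hu
  set v := u * cs.simple 1 with hv
  set w := v * cs.simple 0 with hw
  have hlen5 : cs.length (w * cs.simple 1) = 5 := by
    simpa [cs.wordProd_cons, hu, hv, hw, mul_assoc] using length_wordProd_alternating cs
  have hlen1 : cs.length (cs.simple 1) = 1 := cs.length_simple 1
  have hlen2 := cs.length_mul_simple (cs.simple 1) 0
  have hlen3 := cs.length_mul_simple u 1
  have hlen4 := cs.length_mul_simple v 0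
  have hstep := cs.length_mul_simple w 1
  rw [← hu] at hlen2
  rw [← hv] at hlen3
  rw [← hw] at hlen4
  have hv_s : v = w * cs.simple 0 := by simp [hw]
  have hu_t : u = v * cs.simple 1 := by simp [hv]
  obtain ⟨β, hβ⟩ := exists_eval_eq_mul_pow (hhom u) ((ht u).2 (by rw [← hv]; omega)) (hsign u)
  obtain ⟨α, hα⟩ := exists_eval_eq_mul_pow (hhom w) ((ht w).2 (by omega)) (hsign w)
  rw [show cs.length u = 2 by omega] at hβ
  rw [show cs.length w = 4 by omega] at hα
  have hds := (hs w).1 (by rw [← hv_s]; omega)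
  have hdt := (ht v).1 (by rw [← hu_t]; omega)
  rw [← hv_s] at hds
  rw [← hu_t] at hdt
  have hPv : ∀ a b : ℚ, α * a ^ 4 - α * b ^ 4 = (a - b) * eval ![a, b] (P v) := fun a b ↦ by
    have h := congrArg (eval ![a, b]) hds
    rw [map_sub, eval_aeval_swap, hα, hα] at h
    simpa using h
  have hPu : ∀ a b : ℚ, eval ![a, b] (P v) - eval ![a, a - b] (P v) =
      (-a + 2 * b) * (β * a ^ 2) := fun a b ↦ by
    have h := congrArg (eval ![a, b]) hdt
    rw [map_sub, eval_aeval_reflection] at h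
    simpa [hβ] using h
  have hα0 : α = 0 := by
    have h₁ := hPu 1 2
    have h₂ := hPu 1 3
    have h₃ := hPv 1 2
    have h₄ := hPv 1 (1 - 2)
    have h₅ := hPv 1 3
    have h₆ := hPv 1 (1 - 3)
    linarith
  refine hne w (MvPolynomial.funext fun x ↦ ?_)
  have hx : x = ![x 0, x 1] := by ext i; fin_cases i <;> rfl
  rw [hx, hα, hα0]
  simp
end

section
/- Let k be an algebraically closed field with char k ≠ 2, V a 3-dimensional k-vector space, and β a nondegenerate symmetric bilinear form on V. Then there exists an alternating trilinear form γ on V compatible with β, and it is unique up to sign: if γ₁ and γ₂ are both alternating trilinear forms compatible with β, then γ₂ = γ₁ or γ₂ = −γ₁. -/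
open Module

theorem Module.Basis.det_vecCons₃ {k V : Type*} [CommRing k] [AddCommGroup V] [Module k V]
    (b : Basis (Fin 3) k V) (u v w : V) :
    b.det ![u, v, w] =
      (b.repr u 1 * b.repr v 2 - b.repr u 2 * b.repr v 1) * b.repr w 0 +
      (b.repr u 2 * b.repr v 0 - b.repr u 0 * b.repr v 2) * b.repr w 1 +
      (b.repr u 0 * b.repr v 1 - b.repr u 1 * b.repr v 0) * b.repr w 2 := by
  rw [Basis.det_apply, Matrix.det_fin_three]
  simp [Basis.toMatrix_apply]
  ring

theorem LinearMap.BilinForm.apply_eq_of_isOrtho_basis₃ {k V : Type*} [CommRing k]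
    [AddCommGroup V] [Module k V] (β : V →ₗ[k] V →ₗ[k] k) (b : Basis (Fin 3) k V)
    (hb : ∀ i j, i ≠ j → β (b i) (b j) = 0) (u v : V) :
    β u v = b.repr u 0 * b.repr v 0 * β (b 0) (b 0) +
      b.repr u 1 * b.repr v 1 * β (b 1) (b 1) + b.repr u 2 * b.repr v 2 * β (b 2) (b 2) := by
  conv_lhs => rw [← b.sum_repr u, ← b.sum_repr v]
  simp [Fin.sum_univ_three, hb, -Basis.sum_repr]
  ring

/-- The square of the volume of an orthogonal basis under a form compatible with `β`. -/
theorem two_mul_sq_volume_of_compatible {k V : Type*} [Field k]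
    [AddCommGroup V] [Module k V] (β : V →ₗ[k] V →ₗ[k] k) (b : Basis (Fin 3) k V)
    (hb : ∀ i j, i ≠ j → β (b i) (b j) = 0) (γ : V [⋀^Fin 3]→ₗ[k] k)
    (hγ : ∀ u v : V, ∃ d : V, (∀ x : V, β d x = γ ![u, v, x]) ∧
      2 * γ ![u, v, d] = β u u * β v v - (β u v) ^ 2) :
    2 * γ b ^ 2 = β (b 0) (b 0) * β (b 1) (b 1) * β (b 2) (b 2) := by
  obtain ⟨d, hd, h⟩ := hγ (b 0) (b 1)
  have hx := hd (b 2)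
  rw [γ.eq_smul_basis_det b] at hx h
  simp only [AlternatingMap.smul_apply, smul_eq_mul, b.det_vecCons₃,
    LinearMap.BilinForm.apply_eq_of_isOrtho_basis₃ β b hb d] at hx h
  simp [hb] at hx h
  linear_combination β (b 2) (b 2) * h - 2 * γ b * hx



/-- On a 3-dimensional vector space over an algebraically closed field of
characteristic `≠ 2`, every nondegenerate symmetric bilinear form `β` admits a compatible
alternating trilinear form, which is unique up to sign. -/
theorem dim_three_compatible_exists_unique_up_to_sign
    {k : Type*} [Field k] [IsAlgClosed k] (hchar : (2 : k) ≠ 0)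
    {V : Type*} [AddCommGroup V] [Module k V] [FiniteDimensional k V]
    (hdim : finrank k V = 3)
    (β : V →ₗ[k] V →ₗ[k] k)
    (hβsymm : ∀ u v : V, β u v = β v u)
    (hβnd : ∀ u : V, (∀ v : V, β u v = 0) → u = 0) :
    (∃ γ : V [⋀^Fin 3]→ₗ[k] k, ∀ u v : V, ∃ d : V,
        (∀ x : V, β d x = γ ![u, v, x]) ∧
        2 * γ ![u, v, d] = β u u * β v v - (β u v) ^ 2) ∧
      (∀ γ₁ γ₂ : V [⋀^Fin 3]→ₗ[k] k,
        (∀ u v : V, ∃ d : V, (∀ x : V, β d x = γ₁ ![u, v, x]) ∧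
          2 * γ₁ ![u, v, d] = β u u * β v v - (β u v) ^ 2) →
        (∀ u v : V, ∃ d : V, (∀ x : V, β d x = γ₂ ![u, v, x]) ∧
          2 * γ₂ ![u, v, d] = β u u * β v v - (β u v) ^ 2) →
        γ₂ = γ₁ ∨ γ₂ = -γ₁) := by
  have := invertibleOfNonzero hchar
  have hsymm : LinearMap.IsSymm (I := RingHom.id k) β := ⟨hβsymm⟩
  obtain ⟨b₀, hb₀⟩ := LinearMap.BilinForm.exists_orthogonal_basis hsymm
  let b : Basis (Fin 3) k V := b₀.reindex (finCongr hdim)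
  have hb : ∀ i j, i ≠ j → β (b i) (b j) = 0 := by
    intro i j hij
    simpa [b] using hb₀ (by simpa using hij : (finCongr hdim).symm i ≠ (finCongr hdim).symm j)
  have hβ := LinearMap.BilinForm.apply_eq_of_isOrtho_basis₃ β b hb
  have hne : ∀ i, β (b i) (b i) ≠ 0 := by
    intro i hi
    refine b.ne_zero i (hβnd _ fun v => ?_)
    rw [← b.sum_repr v, map_sum]
    refine Finset.sum_eq_zero fun j _ => ?_
    rcases eq_or_ne i j with rfl | hij
    · simp [hi]
    · simp [hb i j hij]
  have h0 := hne 0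
  have h1 := hne 1
  have h2 := hne 2
  constructor
  · obtain ⟨c, hc⟩ := IsAlgClosed.exists_pow_nat_eq
      (β (b 0) (b 0) * β (b 1) (b 1) * β (b 2) (b 2) / 2) (n := 2) two_pos
    replace hc : 2 * c ^ 2 = β (b 0) (b 0) * β (b 1) (b 1) * β (b 2) (b 2) := by
      rw [hc]; field_simp
    refine ⟨c • b.det, fun u v => ⟨b.equivFun.symm ![
      c * (b.repr u 1 * b.repr v 2 - b.repr u 2 * b.repr v 1) / β (b 0) (b 0),
      c * (b.repr u 2 * b.repr v 0 - b.repr u 0 * b.repr v 2) / β (b 1) (b 1),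
      c * (b.repr u 0 * b.repr v 1 - b.repr u 1 * b.repr v 0) / β (b 2) (b 2)],
      fun x => ?_, ?_⟩⟩
    · rw [hβ, AlternatingMap.smul_apply, b.det_vecCons₃]
      simp only [← Basis.equivFun_apply, LinearEquiv.apply_symm_apply]
      simp
      field_simp
    · rw [hβ u u, hβ v v, hβ u v, AlternatingMap.smul_apply, b.det_vecCons₃]
      simp only [← Basis.equivFun_apply, LinearEquiv.apply_symm_apply]
      simp
      field_simp
      rw [hc]
      ring
  · intro γ₁ γ₂ hγ₁ hγ₂
    have hsq : γ₂ b ^ 2 = γ₁ b ^ 2 := mul_left_cancel₀ hchar <|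
      (two_mul_sq_volume_of_compatible β b hb γ₂ hγ₂).trans
        (two_mul_sq_volume_of_compatible β b hb γ₁ hγ₁).symm
    rcases sq_eq_sq_iff_eq_or_eq_neg.mp hsq with h | h
    · left
      rw [γ₂.eq_smul_basis_det b, γ₁.eq_smul_basis_det b, h]
    · right
      rw [γ₂.eq_smul_basis_det b, γ₁.eq_smul_basis_det b, h]
      ext v
      simp
end
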